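/- Let V be a finite-dimensional vector space over ℚ, W a finite increasing filtration on V, N : V → V nilpotent with N(W_w) ⊆ W_w for all w, and let W' be the relative monodromy filtration of N with respect to W. Let (U'_w)_{w∈ℤ} be a splitting of W' such that N(U'_w) ⊆ U'_{w−2} for all w and which is compatible with W. Then there exists a unique splitting (U_w)_{w∈ℤ} of W such that V = ⊕_{m,n} (U_m ∩ U'_n), and such that, writing N_w for the weight-w component of N in the grading of End(V) induced by (U_w) and N̄_w for the class of N_w in gr^{W'}_{−2} gr^W_w End(V), one has N̄_{−1} = 0 and, for every w ≤ −2, N̄_w lies in the primitive component of gr^{W'}_{−2} gr^W_w End(V). -/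

import Mathlib

open Submodule

section Defs

variable {V : Type*} [AddCommGroup V] [Module ℚ V]

/-- A finite increasing filtration on `V` indexed by `ℤ`: a monotone family of subspaces
which is `⊥` for all sufficiently small indices and `⊤` for all sufficiently large indices. -/
def IsFiniteFiltration (W : ℤ → Submodule ℚ V) : Prop :=
  Monotone W ∧ (∃ a : ℤ, ∀ w : ℤ, w ≤ a → W w = ⊥) ∧ (∃ b : ℤ, ∀ w : ℤ, b ≤ w → W w = ⊤)

/-- `grSub W W' w n = (W'_n ⊓ W_w) ⊔ W_{w-1}`, the submodule of `V` such that
`gr^{W'}_n gr^W_w = grSub W W' w n / grSub W W' w (n-1)`. -/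
def grSub (W W' : ℤ → Submodule ℚ V) (w n : ℤ) : Submodule ℚ V :=
  (W' n ⊓ W w) ⊔ W (w - 1)

/-- `W'` is the relative monodromy filtration of the nilpotent endomorphism `N` with respect to
the filtration `W`:  `W'` is a finite increasing filtration, `N W'_w ⊆ W'_{w-2}` for all `w`, and
for all `w` and `m ≥ 0` the map induced by `N^m` from `gr^{W'}_{w+m} gr^W_w` to
`gr^{W'}_{w-m} gr^W_w` is well defined and bijective (expressed on the level of submodules
of `V`). -/
def IsRelMonFil (N : Module.End ℚ V) (W W' : ℤ → Submodule ℚ V) : Prop :=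
  IsFiniteFiltration W' ∧
  (∀ w : ℤ, ∀ x ∈ W' w, N x ∈ W' (w - 2)) ∧
  ∀ (w : ℤ) (m : ℕ),
    (∀ x ∈ grSub W W' w (w + m), (N ^ m) x ∈ grSub W W' w (w - m)) ∧
    (∀ x ∈ grSub W W' w (w + m - 1), (N ^ m) x ∈ grSub W W' w (w - m - 1)) ∧
    (∀ x ∈ grSub W W' w (w + m), (N ^ m) x ∈ grSub W W' w (w - m - 1) →
      x ∈ grSub W W' w (w + m - 1)) ∧
    grSub W W' w (w - m) ≤
      Submodule.map (N ^ m : Module.End ℚ V) (grSub W W' w (w + m)) ⊔ grSub W W' w (w - m - 1)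

/-- The filtration induced on `End(V)` by a filtration `W` on `V`:
`W_k End(V) = {f | f(W_w) ⊆ W_{w+k} for all w}`. -/
def endFilt (W : ℤ → Submodule ℚ V) (k : ℤ) : Submodule ℚ (Module.End ℚ V) where
  carrier := {f | ∀ w : ℤ, ∀ x ∈ W w, f x ∈ W (w + k)}
  add_mem' := fun hf hg w x hx => by
    simpa using (W (w + k)).add_mem (hf w x hx) (hg w x hx)
  zero_mem' := fun w x _ => by simp
  smul_mem' := fun c f hf w x hx => by
    simpa using (W (w + k)).smul_mem c (hf w x hx)

/-- `Ad(N) : End(V) → End(V)`, `f ↦ N ∘ f - f ∘ N`, as an endomorphism of `End(V)`. -/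
def adE (N : Module.End ℚ V) : Module.End ℚ (Module.End ℚ V) :=
  LinearMap.mulLeft ℚ N - LinearMap.mulRight ℚ N

/-- `U` is a splitting of the filtration `W`: `V = ⊕_w U_w` and `W_w = Σ_{n ≤ w} U_n`. -/
def IsSplitting (W U : ℤ → Submodule ℚ V) : Prop :=
  DirectSum.IsInternal U ∧ ∀ w : ℤ, W w = ⨆ n ≤ w, U n

/-- `c` is the weight decomposition of `f` with respect to the grading `U` of `V`:
`f = Σ_w c_w` (a finite sum) and `c_w (U_m) ⊆ U_{m+w}` for all `m`. -/
def IsWeightDecomp (U : ℤ → Submodule ℚ V) (f : Module.End ℚ V)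
    (c : ℤ → Module.End ℚ V) : Prop :=
  (Function.support c).Finite ∧ (∑ᶠ w : ℤ, c w) = f ∧
  ∀ w m : ℤ, ∀ x ∈ U m, (c w) x ∈ U (m + w)

/-- `U` is the Deligne splitting of `W` associated to the splitting `U'` of `W'`:
a splitting of `W` such that `V = ⊕_{m,n} (U_m ∩ U'_n)` and, for any weight decomposition
`c` of `N` with respect to `U`, the class `N̄_{-1}` of `c_{-1}` in
`gr^{W'}_{-2} gr^W_{-1} End(V)` vanishes and, for `w ≤ -2`, the class `N̄_w` of `c_w`
in `gr^{W'}_{-2} gr^W_w End(V)` lies in the primitive component, i.e. is killed by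
the map induced by `Ad(N)^{-w-1}` to `gr^{W'}_{2w} gr^W_w End(V)`. -/
def IsDeligneSplitting (N : Module.End ℚ V) (W W' U' U : ℤ → Submodule ℚ V) : Prop :=
  IsSplitting W U ∧
  DirectSum.IsInternal (fun p : ℤ × ℤ => U p.1 ⊓ U' p.2) ∧
  ∀ c : ℤ → Module.End ℚ V, IsWeightDecomp U N c →
    c (-1) ∈ grSub (endFilt W) (endFilt W') (-1) (-3) ∧
    ∀ w : ℤ, w ≤ -2 →
      c w ∈ grSub (endFilt W) (endFilt W') w (-2) ∧
      ((adE N) ^ (-w - 1).toNat) (c w) ∈ grSub (endFilt W) (endFilt W') w (2 * w - 1)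

end Defs

section Resolution

variable {ι R : Type*} [Ring R]

/-- `p` is a finite resolution of the identity of the ring `R` into orthogonal idempotents,
supported on `S`. -/
structure IsResolution (p : ι → R) (S : Finset ι) : Prop where
  mul_self : ∀ i, p i * p i = p i
  mul_ne : ∀ i j, i ≠ j → p i * p j = 0
  zero_off : ∀ i, i ∉ S → p i = 0
  sum_eq_one : ∑ i ∈ S, p i = 1

namespace IsResolution

variable {p : ι → R} {S : Finset ι}

theorem sum_superset (hp : IsResolution p S) {T : Finset ι} (h : S ⊆ T) :
    ∑ i ∈ T, p i = 1 := by
  rw [← hp.sum_eq_one]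
  exact (Finset.sum_subset h fun i _ hi => hp.zero_off i hi).symm

theorem ext_right (hp : IsResolution p S) {x y : R} (h : ∀ i, x * p i = y * p i) : x = y := by
  rw [← mul_one x, ← mul_one y, ← hp.sum_eq_one, Finset.mul_sum, Finset.mul_sum]
  exact Finset.sum_congr rfl fun i _ => h i

theorem sum_mul_single (hp : IsResolution p S) (f : ι → R) (i : ι) :
    (∑ j ∈ S, f j * p j) * p i = f i * p i := by
  classical
  rw [Finset.sum_mul, Finset.sum_eq_single i]
  · rw [mul_assoc, hp.mul_self]
  · intro j _ hj
    rw [mul_assoc, hp.mul_ne j i hj, mul_zero]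
  · intro hi
    simp [hp.zero_off i hi]

theorem single_mul_sum (hp : IsResolution p S) (f : ι → R) (i : ι) :
    p i * (∑ j ∈ S, p j * f j) = p i * f i := by
  classical
  rw [Finset.mul_sum, Finset.sum_eq_single i]
  · rw [← mul_assoc, hp.mul_self]
  · intro j _ hj
    rw [← mul_assoc, hp.mul_ne i j hj.symm, zero_mul]
  · intro hi
    simp [hp.zero_off i hi]

theorem conj (hp : IsResolution p S) (u : Rˣ) :
    IsResolution (fun i => (u : R) * p i * (↑u⁻¹ : R)) S where
  mul_self i := by
    have := hp.mul_self i
    calc (u : R) * p i * (↑u⁻¹ : R) * ((u : R) * p i * (↑u⁻¹ : R))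
        = (u : R) * (p i * p i) * (↑u⁻¹ : R) := by simp [mul_assoc]
      _ = _ := by rw [this]
  mul_ne i j h := by
    have := hp.mul_ne i j h
    calc (u : R) * p i * (↑u⁻¹ : R) * ((u : R) * p j * (↑u⁻¹ : R))
        = (u : R) * (p i * p j) * (↑u⁻¹ : R) := by simp [mul_assoc]
      _ = _ := by rw [this]; simp
  zero_off i hi := by simp [hp.zero_off i hi]
  sum_eq_one := by
    rw [← Finset.sum_mul, ← Finset.mul_sum, hp.sum_eq_one]
    simp

end IsResolution

/-- The elements of `R` which are homogeneous of degree `w` with respect to the grading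
given by the idempotents `p`. -/
def IsHomog (p : ℤ → R) (w : ℤ) (f : R) : Prop :=
  ∀ m, f * p m = p (m + w) * f

/-- The component of degree `w` of `f` with respect to the grading given by `p`. -/
def weightComp (p : ℤ → R) (S : Finset ℤ) (w : ℤ) : R →+ R where
  toFun f := ∑ m ∈ S, p (m + w) * f * p m
  map_zero' := by simp
  map_add' f g := by simp [mul_add, add_mul, Finset.sum_add_distrib]

theorem weightComp_apply (p : ℤ → R) (S : Finset ℤ) (w : ℤ) (f : R) :
    weightComp p S w f = ∑ m ∈ S, p (m + w) * f * p m := rfl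

theorem IsHomog.mul {p : ℤ → R} {a b : ℤ} {f g : R} (hf : IsHomog p a f) (hg : IsHomog p b g) :
    IsHomog p (a + b) (f * g) := fun m => by
  rw [mul_assoc, hg m, ← mul_assoc, hf, mul_assoc, add_assoc, add_comm b a]

theorem IsHomog.add {p : ℤ → R} {a : ℤ} {f g : R} (hf : IsHomog p a f) (hg : IsHomog p a g) :
    IsHomog p a (f + g) := fun m => by rw [add_mul, mul_add, hf m, hg m]

theorem IsHomog.sub {p : ℤ → R} {a : ℤ} {f g : R} (hf : IsHomog p a f) (hg : IsHomog p a g) :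
    IsHomog p a (f - g) := fun m => by rw [sub_mul, mul_sub, hf m, hg m]

theorem IsHomog.neg {p : ℤ → R} {a : ℤ} {f : R} (hf : IsHomog p a f) :
    IsHomog p a (-f) := fun m => by rw [neg_mul, mul_neg, hf m]

theorem IsHomog.one {p : ℤ → R} : IsHomog p 0 (1 : R) := fun m => by simp

theorem isHomog_zero_iff {p : ℤ → R} {f : R} : IsHomog p 0 f ↔ ∀ m, Commute f (p m) := by
  simp [IsHomog, Commute, SemiconjBy]

namespace IsResolution

variable {p p' : ℤ → R} {S S' : Finset ℤ}

theorem weightComp_mul_single (hp : IsResolution p S) (w m : ℤ) (f : R) :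
    weightComp p S w f * p m = p (m + w) * f * p m := by
  rw [weightComp_apply, hp.sum_mul_single (fun m => p (m + w) * f)]

theorem single_mul_weightComp (hp : IsResolution p S) (w m : ℤ) (f : R) :
    p (m + w) * weightComp p S w f = p (m + w) * f * p m := by
  rw [weightComp_apply, Finset.mul_sum, Finset.sum_eq_single m]
  · rw [mul_assoc (p (m + w)) f, ← mul_assoc, hp.mul_self]
  · intro j _ hj
    rw [mul_assoc (p (j + w)), ← mul_assoc (p (m + w)), hp.mul_ne _ _ (by omega), zero_mul]
  · intro hm
    simp [hp.zero_off m hm]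

theorem isHomog_weightComp (hp : IsResolution p S) (w : ℤ) (f : R) :
    IsHomog p w (weightComp p S w f) := fun m => by
  rw [hp.weightComp_mul_single, hp.single_mul_weightComp]

theorem weightComp_of_isHomog (hp : IsResolution p S) {w : ℤ} {f : R} (hf : IsHomog p w f) :
    weightComp p S w f = f :=
  hp.ext_right fun m => by
    rw [hp.weightComp_mul_single, ← hf m, mul_assoc, hp.mul_self]

theorem weightComp_of_ne (hp : IsResolution p S) {v w : ℤ} {f : R} (hf : IsHomog p v f)
    (h : w ≠ v) : weightComp p S w f = 0 :=
  hp.ext_right fun m => by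
    rw [hp.weightComp_mul_single, mul_assoc, hf m, ← mul_assoc,
      hp.mul_ne _ _ (by omega), zero_mul, zero_mul]

theorem weightComp_mul_right (hp : IsResolution p S) {a b : ℤ} (f : R) {g : R}
    (hg : IsHomog p b g) : weightComp p S (a + b) (f * g) = weightComp p S a f * g :=
  hp.ext_right fun m => by
    rw [hp.weightComp_mul_single, mul_assoc _ g, hg m, ← mul_assoc _ (p (m + b)),
      hp.weightComp_mul_single, mul_assoc _ _ (p m), mul_assoc f, hg m]
    simp only [mul_assoc]
    rw [add_comm a b, add_assoc]

theorem weightComp_mul_left (hp : IsResolution p S) {a b : ℤ} (f : R) {g : R}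
    (hg : IsHomog p b g) : weightComp p S (b + a) (g * f) = g * weightComp p S a f :=
  hp.ext_right fun m => by
    rw [hp.weightComp_mul_single, mul_assoc g, hp.weightComp_mul_single, ← mul_assoc,
      ← mul_assoc g, ← mul_assoc g, hg (m + a), add_assoc, add_comm b a]

theorem exists_sum_weightComp (hp : IsResolution p S) : ∃ T : Finset ℤ,
    (∀ f : R, ∑ w ∈ T, weightComp p S w f = f) ∧ ∀ w, w ∉ T → ∀ f, weightComp p S w f = 0 := by
  refine ⟨(S ×ˢ S).image fun x => x.1 - x.2, fun f => ?_, fun w hw f => ?_⟩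
  · refine hp.ext_right fun m => ?_
    by_cases hm : m ∈ S
    · rw [Finset.sum_mul]
      simp only [hp.weightComp_mul_single, mul_assoc]
      rw [← Finset.sum_mul]
      convert one_mul (f * p m)
      refine (Finset.sum_map _ ⟨fun w => m + w, add_right_injective m⟩ p).symm.trans ?_
      refine hp.sum_superset fun n hn => ?_
      simp only [Finset.mem_map, Finset.mem_image, Finset.mem_product, Function.Embedding.coeFn_mk]
      exact ⟨n - m, ⟨(n, m), ⟨hn, hm⟩, rfl⟩, by ring⟩
    · simp [hp.zero_off m hm]
  · rw [weightComp_apply]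
    refine Finset.sum_eq_zero fun m hm => ?_
    rw [hp.zero_off (m + w), zero_mul, zero_mul]
    intro h
    exact hw (Finset.mem_image.2 ⟨(m + w, m), Finset.mem_product.2 ⟨h, hm⟩, by simp⟩)

theorem weightComp_comm (hc : ∀ m n, Commute (p m) (p' n)) (a b : ℤ) (f : R) :
    weightComp p S a (weightComp p' S' b f) = weightComp p' S' b (weightComp p S a f) := by
  simp only [weightComp_apply, Finset.mul_sum, Finset.sum_mul]
  rw [Finset.sum_comm]
  refine Finset.sum_congr rfl fun n _ => Finset.sum_congr rfl fun m _ => ?_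
  calc p (m + a) * (p' (n + b) * f * p' n) * p m
      = (p (m + a) * p' (n + b)) * f * (p' n * p m) := by simp only [mul_assoc]
    _ = (p' (n + b) * p (m + a)) * f * (p m * p' n) := by
        rw [(hc (m + a) (n + b)).eq, (hc m n).eq]
    _ = _ := by simp only [mul_assoc]

theorem isHomog_weightComp_of_isHomog (hp' : IsResolution p' S')
    (hc : ∀ m n, Commute (p m) (p' n)) {b : ℤ} {f : R} (hf : IsHomog p' b f) (a : ℤ) :
    IsHomog p' b (weightComp p S a f) := by
  rw [← hp'.weightComp_of_isHomog hf, weightComp_comm hc]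
  exact hp'.isHomog_weightComp _ _

theorem weightComp_conj (u : Rˣ) (w : ℤ) (f : R) :
    weightComp (fun i => (u : R) * p i * (↑u⁻¹ : R)) S w f =
      u * weightComp p S w ((↑u⁻¹ : R) * f * u) * (↑u⁻¹ : R) := by
  simp only [weightComp_apply, Finset.mul_sum, Finset.sum_mul, mul_assoc]

end IsResolution

end Resolution

section Filtration

variable {V : Type*} [AddCommGroup V] [Module ℚ V]

theorem IsResolution.mem_range_iff {ι : Type*} {p : ι → Module.End ℚ V} {S : Finset ι}
    (hp : IsResolution p S) {i : ι} {v : V} : v ∈ LinearMap.range (p i) ↔ p i v = v := by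
  refine ⟨?_, fun h => ⟨v, h⟩⟩
  rintro ⟨x, rfl⟩
  rw [← Module.End.mul_apply, hp.mul_self]

theorem IsResolution.sum_apply {ι : Type*} {p : ι → Module.End ℚ V} {S : Finset ι}
    (hp : IsResolution p S) (v : V) : ∑ i ∈ S, p i v = v := by
  have := congrArg (fun f : Module.End ℚ V => f v) hp.sum_eq_one
  simpa using this

theorem IsResolution.isInternal_range {ι : Type*} [DecidableEq ι] {p : ι → Module.End ℚ V}
    {S : Finset ι} (hp : IsResolution p S) :
    DirectSum.IsInternal fun i => LinearMap.range (p i) := by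
  rw [DirectSum.isInternal_submodule_iff_iSupIndep_and_iSup_eq_top]
  constructor
  · intro i
    rw [Submodule.disjoint_def]
    intro x hx hx'
    have hle : ⨆ j, ⨆ (_ : j ≠ i), LinearMap.range (p j) ≤ LinearMap.ker (p i) := by
      refine iSup₂_le fun j hj => ?_
      rintro _ ⟨y, rfl⟩
      rw [LinearMap.mem_ker, ← Module.End.mul_apply, hp.mul_ne i j hj.symm, LinearMap.zero_apply]
    rw [← hp.mem_range_iff.1 hx]
    exact hle hx'
  · rw [eq_top_iff]
    intro v _
    rw [← hp.sum_apply v]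
    exact Submodule.sum_mem _ fun i _ => Submodule.mem_iSup_of_mem i ⟨v, rfl⟩

/-- Every internal direct sum decomposition of a finite-dimensional space comes from a
resolution of the identity. -/
theorem exists_isResolution_of_isInternal {ι : Type*} [DecidableEq ι] [FiniteDimensional ℚ V]
    {U : ι → Submodule ℚ V} (hU : DirectSum.IsInternal U) :
    ∃ (p : ι → Module.End ℚ V) (S : Finset ι),
      IsResolution p S ∧ ∀ i, LinearMap.range (p i) = U i := by
  classical
  let := hU.chooseDecomposition
  let p : ι → Module.End ℚ V := fun i =>
    (U i).subtype ∘ₗ DirectSum.component ℚ ι (fun i => U i) i ∘ₗ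
      (DirectSum.decomposeLinearEquiv U).toLinearMap
  have hpa : ∀ i v, p i v = (DirectSum.decompose U v i : V) := fun i v => rfl
  have hmem : ∀ i v, p i v ∈ U i := fun i v => by rw [hpa]; exact Submodule.coe_mem _
  have hself : ∀ i, ∀ v ∈ U i, p i v = v := fun i v hv => by
    rw [hpa, DirectSum.decompose_of_mem_same _ hv]
  have hne : ∀ i j, j ≠ i → ∀ v ∈ U j, p i v = 0 := fun i j hij v hv => by
    rw [hpa, DirectSum.decompose_of_mem_ne _ hv hij]
  have hfin : {i | U i ≠ ⊥}.Finite :=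
    WellFoundedGT.finite_ne_bot_of_iSupIndep hU.submodule_iSupIndep
  have hoff : ∀ i, i ∉ hfin.toFinset → p i = 0 := fun i hi => by
    have hbot : U i = ⊥ := by simpa using hi
    ext v
    have := hmem i v
    rwa [hbot, Submodule.mem_bot] at this
  refine ⟨p, hfin.toFinset, ⟨fun i => ?_, fun i j hij => ?_, hoff, ?_⟩, fun i => ?_⟩
  · ext v
    exact hself i _ (hmem i v)
  · ext v
    exact hne i j hij.symm _ (hmem j v)
  · ext v
    have hv : v ∈ ⨆ i, U i := by rw [hU.submodule_iSup_eq_top]; trivial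
    simp only [LinearMap.sum_apply, Module.End.one_apply]
    induction hv using Submodule.iSup_induction' with
    | mem i x hx =>
      rw [Finset.sum_eq_single i (fun j _ hj => hne j i hj.symm x hx), hself i x hx]
      intro hi
      rw [hoff i hi, LinearMap.zero_apply]
    | zero => simp
    | add x y _ _ hx hy => simp only [map_add, Finset.sum_add_distrib, hx, hy]
  · refine le_antisymm ?_ fun v hv => ⟨v, hself i v hv⟩
    rintro _ ⟨v, rfl⟩
    exact hmem i v

/-- The grading given by the idempotents `p` splits the filtration `W`. -/
structure IsFiltSplitting (p : ℤ → Module.End ℚ V) (W : ℤ → Submodule ℚ V) : Prop where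
  apply_mem : ∀ m v, p m v ∈ W m
  apply_eq_zero : ∀ w m, w < m → ∀ v ∈ W w, p m v = 0

variable {p p' : ℤ → Module.End ℚ V} {S S' : Finset ℤ} {W W' U' : ℤ → Submodule ℚ V}

theorem IsResolution.isSplitting_range_iff (hp : IsResolution p S) (hW : Monotone W) :
    IsSplitting W (fun m => LinearMap.range (p m)) ↔ IsFiltSplitting p W := by
  constructor
  · rintro ⟨-, h⟩
    refine ⟨fun m v => ?_, fun w m hm v hv => ?_⟩
    · rw [h]
      exact Submodule.mem_iSup_of_mem m (Submodule.mem_iSup_of_mem le_rfl ⟨v, rfl⟩)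
    · rw [h] at hv
      have hle : ⨆ n ≤ w, LinearMap.range (p n) ≤ LinearMap.ker (p m) := by
        refine iSup₂_le fun n hn => ?_
        rintro _ ⟨y, rfl⟩
        rw [LinearMap.mem_ker, ← Module.End.mul_apply, hp.mul_ne m n (by omega),
          LinearMap.zero_apply]
      exact hle hv
  · intro h
    refine ⟨hp.isInternal_range, fun w => le_antisymm (fun v hv => ?_) ?_⟩
    · rw [← hp.sum_apply v]
      refine Submodule.sum_mem _ fun m _ => ?_
      by_cases hm : w < m
      · rw [h.apply_eq_zero w m hm v hv]
        exact Submodule.zero_mem _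
      · exact Submodule.mem_iSup_of_mem m (Submodule.mem_iSup_of_mem (not_lt.1 hm) ⟨v, rfl⟩)
    · refine iSup₂_le fun n hn => ?_
      rintro _ ⟨y, rfl⟩
      exact hW hn (h.apply_mem n y)

theorem IsHomog.mem_endFilt {w : ℤ} {f : Module.End ℚ V} (hf : IsHomog p w f)
    (hp : IsResolution p S) (hs : IsFiltSplitting p W) (hW : Monotone W) :
    f ∈ endFilt W w := by
  intro a x hx
  rw [← hp.sum_apply x, map_sum]
  refine Submodule.sum_mem _ fun m _ => ?_
  by_cases hm : a < m
  · rw [hs.apply_eq_zero a m hm x hx, map_zero]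
    exact Submodule.zero_mem _
  · rw [← Module.End.mul_apply, hf m]
    exact hW (by omega) (hs.apply_mem (m + w) _)

theorem endFilt_mono (hW : Monotone W) : Monotone (endFilt W) := fun _ _ hab _ hf w x hx =>
  hW (by omega) (hf w x hx)

theorem mul_mem_endFilt {a b : ℤ} {f g : Module.End ℚ V} (hf : f ∈ endFilt W a)
    (hg : g ∈ endFilt W b) : f * g ∈ endFilt W (a + b) := fun w x hx => by
  have := hf _ _ (hg w x hx)
  rwa [add_assoc, add_comm b a] at this

theorem one_mem_endFilt : (1 : Module.End ℚ V) ∈ endFilt W 0 := fun w x hx => by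
  simpa using hx

theorem weightComp_eq_zero_of_mem (hs : IsFiltSplitting p W) {k w : ℤ} (h : k < w)
    {f : Module.End ℚ V} (hf : f ∈ endFilt W k) : weightComp p S w f = 0 := by
  rw [weightComp_apply]
  refine Finset.sum_eq_zero fun m _ => ?_
  ext v
  exact hs.apply_eq_zero (m + k) (m + w) (by omega) _ (hf _ _ (hs.apply_mem m v))

theorem mem_endFilt_iff (hp : IsResolution p S) (hs : IsFiltSplitting p W) (hW : Monotone W)
    {k : ℤ} {f : Module.End ℚ V} :
    f ∈ endFilt W k ↔ ∀ w, k < w → weightComp p S w f = 0 := by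
  refine ⟨fun hf w hw => weightComp_eq_zero_of_mem hs hw hf, fun h => ?_⟩
  obtain ⟨T, hT, -⟩ := hp.exists_sum_weightComp
  rw [← hT f]
  refine Submodule.sum_mem _ fun w _ => ?_
  by_cases hw : k < w
  · rw [h w hw]
    exact Submodule.zero_mem _
  · exact endFilt_mono hW (not_lt.1 hw) ((hp.isHomog_weightComp w f).mem_endFilt hp hs hW)

theorem sub_weightComp_mem (hp : IsResolution p S) (hs : IsFiltSplitting p W) (hW : Monotone W)
    {k : ℤ} {f : Module.End ℚ V} (hf : f ∈ endFilt W k) :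
    f - weightComp p S k f ∈ endFilt W (k - 1) := by
  rw [mem_endFilt_iff hp hs hW]
  intro w hw
  rw [map_sub]
  rcases eq_or_ne w k with rfl | hne
  · rw [hp.weightComp_of_isHomog (hp.isHomog_weightComp w f), sub_self]
  · rw [hp.weightComp_of_ne (hp.isHomog_weightComp k f) hne,
      weightComp_eq_zero_of_mem hs (by omega) hf, sub_zero]

theorem mem_endFilt_sub_one (hp : IsResolution p S) (hs : IsFiltSplitting p W) (hW : Monotone W)
    {k : ℤ} {f : Module.End ℚ V} (hf : f ∈ endFilt W k) (h : weightComp p S k f = 0) :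
    f ∈ endFilt W (k - 1) := by
  simpa [h] using sub_weightComp_mem hp hs hW hf

/-- The symbol of a product is the product of the symbols. -/
theorem weightComp_mul (hp : IsResolution p S) (hs : IsFiltSplitting p W) (hW : Monotone W)
    {a b : ℤ} {f g : Module.End ℚ V} (hf : f ∈ endFilt W a) (hg : g ∈ endFilt W b) :
    weightComp p S (a + b) (f * g) = weightComp p S a f * weightComp p S b g := by
  have h : f * g = weightComp p S a f * g + (f - weightComp p S a f) * g := by
    rw [sub_mul, add_sub_cancel]
  rw [h, map_add, hp.weightComp_mul_left g (hp.isHomog_weightComp a f),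
    weightComp_eq_zero_of_mem hs (by omega)
      (mul_mem_endFilt (sub_weightComp_mem hp hs hW hf) hg), add_zero]

theorem adE_apply (N f : Module.End ℚ V) : adE N f = N * f - f * N := rfl

theorem IsHomog.adE {a b : ℤ} {N f : Module.End ℚ V} (hN : IsHomog p a N) (hf : IsHomog p b f) :
    IsHomog p (a + b) (adE N f) := by
  rw [adE_apply]
  refine (hN.mul hf).sub ?_
  rw [add_comm]
  exact hf.mul hN

theorem IsHomog.adE_pow {a b : ℤ} {N f : Module.End ℚ V} (hN : IsHomog p a N)
    (hf : IsHomog p b f) (k : ℕ) : IsHomog p (k * a + b) ((_root_.adE N ^ k) f) := by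
  induction k with
  | zero => simpa using hf
  | succ k ih =>
    rw [pow_succ', Module.End.mul_apply]
    convert hN.adE ih using 1
    push_cast
    ring

theorem adE_mem_endFilt {a b : ℤ} {N f : Module.End ℚ V} (hN : N ∈ endFilt W a)
    (hf : f ∈ endFilt W b) : adE N f ∈ endFilt W (a + b) := by
  rw [adE_apply]
  refine Submodule.sub_mem _ (mul_mem_endFilt hN hf) ?_
  rw [add_comm]
  exact mul_mem_endFilt hf hN

theorem weightComp_adE (hp : IsResolution p S) (hs : IsFiltSplitting p W) (hW : Monotone W)
    {a b : ℤ} {N f : Module.End ℚ V} (hN : N ∈ endFilt W a) (hf : f ∈ endFilt W b) :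
    weightComp p S (a + b) (adE N f) = adE (weightComp p S a N) (weightComp p S b f) := by
  rw [adE_apply, adE_apply, map_sub, weightComp_mul hp hs hW hN hf, add_comm a b,
    weightComp_mul hp hs hW hf hN]

theorem adE_pow_mem_endFilt {b : ℤ} {N f : Module.End ℚ V} (hN : N ∈ endFilt W 0)
    (hf : f ∈ endFilt W b) (k : ℕ) : (adE N ^ k) f ∈ endFilt W b := by
  induction k with
  | zero => simpa using hf
  | succ k ih =>
    rw [pow_succ', Module.End.mul_apply]
    simpa using adE_mem_endFilt hN ih

theorem weightComp_adE_pow (hp : IsResolution p S) (hs : IsFiltSplitting p W) (hW : Monotone W)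
    {b : ℤ} {N f : Module.End ℚ V} (hN : N ∈ endFilt W 0) (hf : f ∈ endFilt W b) (k : ℕ) :
    weightComp p S b ((adE N ^ k) f) = (adE (weightComp p S 0 N) ^ k) (weightComp p S b f) := by
  induction k with
  | zero => simp
  | succ k ih =>
    rw [pow_succ', pow_succ', Module.End.mul_apply, Module.End.mul_apply, ← ih,
      ← weightComp_adE hp hs hW hN (adE_pow_mem_endFilt hN hf k), zero_add]

theorem weightComp_weightComp_eq_zero_of_mem_grSub (hs : IsFiltSplitting p W)
    (hs' : IsFiltSplitting p' W') (hc : ∀ m n, Commute (p m) (p' n))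
    {w n b : ℤ} (hb : n < b) {f : Module.End ℚ V}
    (hf : f ∈ grSub (endFilt W) (endFilt W') w n) :
    weightComp p' S' b (weightComp p S w f) = 0 := by
  obtain ⟨y, hy, z, hz, rfl⟩ := Submodule.mem_sup.1 hf
  rw [map_add, map_add, weightComp_eq_zero_of_mem hs (by omega) hz, map_zero, add_zero,
    ← IsResolution.weightComp_comm hc, weightComp_eq_zero_of_mem hs' hb hy.1, map_zero]

theorem IsResolution.isHomog_of_mapsTo (hp : IsResolution p S) {w : ℤ} {f : Module.End ℚ V}
    (h : ∀ m, ∀ x ∈ LinearMap.range (p m), f x ∈ LinearMap.range (p (m + w))) :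
    IsHomog p w f := by
  have key : ∀ m, f * p m = p (m + w) * (f * p m) := fun m => by
    ext v
    exact (hp.mem_range_iff.1 (h m _ ⟨v, rfl⟩)).symm
  intro m
  refine hp.ext_right fun j => ?_
  rcases eq_or_ne j m with rfl | hj
  · rw [mul_assoc, hp.mul_self, mul_assoc, ← key]
  · rw [mul_assoc, hp.mul_ne m j hj.symm, mul_assoc, key j, ← mul_assoc,
      hp.mul_ne _ _ (by omega), mul_zero, zero_mul]

theorem IsHomog.mapsTo {w m : ℤ} {f : Module.End ℚ V}
    (hf : IsHomog p w f) {x : V} (hx : x ∈ LinearMap.range (p m)) :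
    f x ∈ LinearMap.range (p (m + w)) := by
  obtain ⟨y, rfl⟩ := hx
  rw [← Module.End.mul_apply, hf m]
  exact ⟨_, rfl⟩

theorem IsResolution.isWeightDecomp_weightComp (hp : IsResolution p S) (f : Module.End ℚ V) :
    IsWeightDecomp (fun m => LinearMap.range (p m)) f fun w => weightComp p S w f := by
  obtain ⟨T, hT, hT'⟩ := hp.exists_sum_weightComp
  have hsub : Function.support (fun w => weightComp p S w f) ⊆ T := fun w hw => by
    by_contra hwT
    exact hw (hT' w hwT f)
  refine ⟨T.finite_toSet.subset hsub, ?_, fun w m x hx =>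
    (hp.isHomog_weightComp w f).mapsTo hx⟩
  rw [finsum_eq_sum_of_support_subset _ hsub, hT]

theorem IsWeightDecomp.eq_weightComp (hp : IsResolution p S) {f : Module.End ℚ V}
    {c : ℤ → Module.End ℚ V} (hc : IsWeightDecomp (fun m => LinearMap.range (p m)) f c) (w : ℤ) :
    c w = weightComp p S w f := by
  obtain ⟨hfin, hsum, hmap⟩ := hc
  have hh : ∀ v, IsHomog p v (c v) := fun v => hp.isHomog_of_mapsTo (hmap v)
  rw [← hsum, finsum_eq_sum c hfin, map_sum, Finset.sum_eq_single w]
  · exact (hp.weightComp_of_isHomog (hh w)).symm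
  · exact fun v _ hv => hp.weightComp_of_ne (hh v) hv.symm
  · intro hw
    rw [show c w = 0 by simpa using hw, map_zero]

theorem IsResolution.isInternal_inf (hp : IsResolution p S) (hp' : IsResolution p' S')
    (hc : ∀ m n, Commute (p m) (p' n)) :
    DirectSum.IsInternal fun x : ℤ × ℤ => LinearMap.range (p x.1) ⊓ LinearMap.range (p' x.2) := by
  have hq : IsResolution (fun x : ℤ × ℤ => p x.1 * p' x.2) (S ×ˢ S') := by
    have hmul : ∀ x y : ℤ × ℤ,
        p x.1 * p' x.2 * (p y.1 * p' y.2) = p x.1 * p y.1 * (p' x.2 * p' y.2) := fun x y =>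
      (hc y.1 x.2).symm.mul_mul_mul_comm _ _
    refine ⟨fun x => ?_, fun x y hxy => ?_, fun x hx => ?_, ?_⟩
    · rw [hmul, hp.mul_self, hp'.mul_self]
    · rw [hmul]
      by_cases h1 : x.1 = y.1
      · rw [hp'.mul_ne x.2 y.2 fun h2 => hxy (Prod.ext h1 h2), mul_zero]
      · rw [hp.mul_ne x.1 y.1 h1, zero_mul]
    · rw [Finset.mem_product, not_and_or] at hx
      rcases hx with hx | hx
      · rw [hp.zero_off _ hx, zero_mul]
      · rw [hp'.zero_off _ hx, mul_zero]
    · rw [Finset.sum_product, ← Finset.sum_mul_sum, hp.sum_eq_one, hp'.sum_eq_one, one_mul]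
  convert hq.isInternal_range using 2 with x
  ext v
  rw [Submodule.mem_inf, hp.mem_range_iff, hp'.mem_range_iff]
  constructor
  · rintro ⟨h1, h2⟩
    exact ⟨v, by rw [Module.End.mul_apply, h2, h1]⟩
  · rintro ⟨v, rfl⟩
    refine ⟨?_, ?_⟩
    · rw [← Module.End.mul_apply, ← mul_assoc, hp.mul_self]
    · rw [← Module.End.mul_apply, (hc _ _).eq, ← mul_assoc, hp'.mul_self]

theorem IsResolution.commute_of_isInternal_inf (hp : IsResolution p S) (hp' : IsResolution p' S')
    (h : DirectSum.IsInternal fun x : ℤ × ℤ =>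
      LinearMap.range (p x.1) ⊓ LinearMap.range (p' x.2)) (m n : ℤ) :
    Commute (p m) (p' n) := by
  have hle : ⨆ x : ℤ × ℤ, LinearMap.range (p x.1) ⊓ LinearMap.range (p' x.2) ≤
      LinearMap.eqLocus (p m * p' n) (p' n * p m) := by
    refine iSup_le fun x v hv => ?_
    rw [Submodule.mem_inf, hp.mem_range_iff, hp'.mem_range_iff] at hv
    have h1 : p m v = if m = x.1 then v else 0 := by
      split_ifs with hm
      · rw [hm, hv.1]
      · rw [← hv.1, ← Module.End.mul_apply, hp.mul_ne _ _ hm, LinearMap.zero_apply]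
    have h2 : p' n v = if n = x.2 then v else 0 := by
      split_ifs with hn
      · rw [hn, hv.2]
      · rw [← hv.2, ← Module.End.mul_apply, hp'.mul_ne _ _ hn, LinearMap.zero_apply]
    rw [LinearMap.mem_eqLocus, Module.End.mul_apply, Module.End.mul_apply, h1, h2]
    split_ifs <;> simp [*]
  rw [h.submodule_iSup_eq_top] at hle
  ext v
  exact hle (Submodule.mem_top : v ∈ ⊤)

/-- The components of negative weight of `N` are primitive, those of weight `-1` vanish. -/
def HasPrimitiveComps (p : ℤ → Module.End ℚ V) (S : Finset ℤ) (N : Module.End ℚ V) : Prop :=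
  ∀ k : ℕ, (adE (weightComp p S 0 N) ^ k) (weightComp p S (-(k + 1)) N) = 0

theorem isDeligneSplitting_range_iff (hp : IsResolution p S) (hs : IsFiltSplitting p W)
    (hW : Monotone W) (hp' : IsResolution p' S') (hs' : IsFiltSplitting p' W')
    (hW' : Monotone W') (hc : ∀ m n, Commute (p m) (p' n)) {N : Module.End ℚ V}
    (hN : N ∈ endFilt W 0) (hN' : IsHomog p' (-2) N) :
    IsDeligneSplitting N W W' (fun n => LinearMap.range (p' n)) (fun m => LinearMap.range (p m)) ↔
      HasPrimitiveComps p S N := by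
  have hhom : ∀ w, IsHomog p' (-2) (weightComp p S w N) := fun w =>
    hp'.isHomog_weightComp_of_isHomog hc hN' w
  have hself : ∀ w, weightComp p S w (weightComp p S w N) = weightComp p S w N := fun w =>
    hp.weightComp_of_isHomog (hp.isHomog_weightComp w N)
  have hmem : ∀ w, weightComp p S w N ∈ endFilt W w := fun w =>
    (hp.isHomog_weightComp w N).mem_endFilt hp hs hW
  constructor
  · rintro ⟨-, -, h⟩ k
    obtain ⟨h1, h2⟩ := h _ (hp.isWeightDecomp_weightComp N)
    rcases Nat.eq_zero_or_pos k with rfl | hk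
    · have := weightComp_weightComp_eq_zero_of_mem_grSub (S := S) (S' := S') hs hs' hc
        (show (-3 : ℤ) < -2 by norm_num) h1
      rw [hself, hp'.weightComp_of_isHomog (hhom _)] at this
      simpa using this
    · obtain ⟨-, h3⟩ := h2 (-(k + 1)) (by omega)
      have := weightComp_weightComp_eq_zero_of_mem_grSub (S := S) (S' := S') hs hs' hc
        (show 2 * (-(k + 1) : ℤ) - 1 < 2 * (-(k + 1)) by omega) h3
      rw [show (-(-((k : ℤ) + 1)) - 1).toNat = k by omega,
        weightComp_adE_pow hp hs hW hN (hmem _), hself, hp'.weightComp_of_isHomog] at this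
      · exact this
      · convert (hhom 0).adE_pow (hhom (-(k + 1))) k using 1
        ring
  · intro h
    refine ⟨(hp.isSplitting_range_iff hW).2 hs, hp.isInternal_inf hp' hc, fun c hcd => ?_⟩
    obtain rfl : c = fun w => weightComp p S w N := funext (hcd.eq_weightComp hp)
    refine ⟨?_, fun w hw => ⟨?_, ?_⟩⟩
    · have := h 0
      simp only [pow_zero, Nat.cast_zero, zero_add, Module.End.one_apply] at this
      simp only [this]
      exact Submodule.zero_mem _
    · exact Submodule.mem_sup_left ⟨(hhom w).mem_endFilt hp' hs' hW', hmem w⟩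
    · have := h (-w - 1).toNat
      rw [show (-(((-w - 1).toNat : ℤ) + 1)) = w by omega] at this
      refine Submodule.mem_sup_right (mem_endFilt_sub_one hp hs hW
        (adE_pow_mem_endFilt hN (hmem w) _) ?_)
      rw [weightComp_adE_pow hp hs hW hN (hmem _), hself, this]

end Filtration

section Lefschetz

variable {M : Type*} [AddCommGroup M] [Module ℚ M] {A B D : Module.End ℚ M}

theorem weight_pow_apply (hDA : ∀ v, D (A v) = A (D v) - (2 : ℚ) • A v) {μ : ℚ} {v : M}
    (hv : D v = μ • v) (k : ℕ) : D ((A ^ k) v) = (μ - 2 * k) • (A ^ k) v := by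
  induction k with
  | zero => simpa using hv
  | succ k ih =>
    rw [pow_succ', Module.End.mul_apply, hDA, ih, map_smul]
    push_cast
    module

theorem apply_pow_succ_of_weight (hBA : ∀ v, B (A v) = A (B v) + D v)
    (hDA : ∀ v, D (A v) = A (D v) - (2 : ℚ) • A v) {μ : ℚ} {v : M} (hv : D v = μ • v) (k : ℕ) :
    B ((A ^ (k + 1)) v) = (A ^ (k + 1)) (B v) + ((k + 1) * (μ - k)) • (A ^ k) v := by
  induction k with
  | zero => simp [hBA, hv]
  | succ k ih =>
    have hA : ∀ x j, (A ^ (j + 1)) x = A ((A ^ j) x) := fun x j => by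
      rw [pow_succ', Module.End.mul_apply]
    rw [hA _ (k + 1), hA _ (k + 1), hBA, ih, weight_pow_apply hDA hv, map_add, map_smul, ← hA v k]
    push_cast
    module

theorem exists_pow_apply_eq_zero_of_weight [FiniteDimensional ℚ M]
    (hDB : ∀ v, D (B v) = B (D v) + (2 : ℚ) • B v) {μ : ℚ} {v : M} (hv : D v = μ • v) :
    ∃ r : ℕ, (B ^ r) v = 0 := by
  by_contra! hne
  have hw : ∀ r : ℕ, D ((B ^ r) v) = (μ + 2 * r) • (B ^ r) v := fun r => by
    induction r with
    | zero => simpa using hv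
    | succ r ih =>
      rw [pow_succ', Module.End.mul_apply, hDB, ih, map_smul]
      push_cast
      module
  refine Set.infinite_of_injective_forall_mem (f := fun r : ℕ => μ + 2 * (r : ℚ)) ?_ ?_
    (Module.End.finite_hasEigenvalue D)
  · intro a b hab
    simpa using hab
  · intro r
    exact Module.End.hasEigenvalue_of_hasEigenvector
      ⟨Module.End.mem_eigenspace_iff.2 (hw r), hne r⟩

/-- Hard Lefschetz, injectivity: the `m`-th power of the lowering operator of an `sl₂`-triple is
injective on vectors of weight `m`. -/
theorem eq_zero_of_pow_apply_eq_zero_of_weight [FiniteDimensional ℚ M]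
    (hBA : ∀ v, B (A v) = A (B v) + D v)
    (hDA : ∀ v, D (A v) = A (D v) - (2 : ℚ) • A v)
    (hDB : ∀ v, D (B v) = B (D v) + (2 : ℚ) • B v)
    {m : ℕ} {v : M} (hv : D v = (m : ℚ) • v) (h : (A ^ m) v = 0) : v = 0 := by
  obtain ⟨r, hr⟩ := exists_pow_apply_eq_zero_of_weight hDB hv
  induction r generalizing m v with
  | zero => simpa using hr
  | succ r ih =>
    have hB : B v = 0 := by
      refine ih (m := m + 2) ?_ ?_ ?_
      · rw [hDB, hv, map_smul]
        push_cast
        module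
      · have h1 := apply_pow_succ_of_weight hBA hDA hv (m + 1)
        have h2 : (A ^ (m + 1)) v = 0 := by rw [pow_succ', Module.End.mul_apply, h, map_zero]
        have h3 : (A ^ (m + 1 + 1)) v = 0 := by rw [pow_succ', Module.End.mul_apply, h2, map_zero]
        rw [h2, h3, map_zero, smul_zero, add_zero] at h1
        exact h1.symm
      · rwa [← Module.End.mul_apply, ← pow_succ]
    have hdesc : ∀ k ≤ m, (A ^ k) v = 0 → v = 0 := by
      intro k
      induction k with
      | zero => exact fun _ hk => by simpa using hk
      | succ k ihk =>
        intro hkm hk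
        refine ihk (by omega) ?_
        have h1 := apply_pow_succ_of_weight hBA hDA hv k
        rw [hk, hB, map_zero, map_zero, zero_add] at h1
        have hpos : ((k : ℚ) + 1) * (m - k) ≠ 0 := by
          have : (k : ℚ) + 1 ≤ m := by exact_mod_cast hkm
          have : (0 : ℚ) ≤ k := k.cast_nonneg
          refine mul_ne_zero ?_ ?_ <;> linarith
        exact (smul_eq_zero.1 h1.symm).resolve_left hpos
    exact hdesc m le_rfl h

/-- Hard Lefschetz, surjectivity: the `m`-th power of the lowering operator of an `sl₂`-triple maps
vectors of weight `m` onto vectors of weight `-m`. -/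
theorem exists_pow_apply_eq_of_weight [FiniteDimensional ℚ M]
    (hBA : ∀ v, B (A v) = A (B v) + D v)
    (hDA : ∀ v, D (A v) = A (D v) - (2 : ℚ) • A v)
    (hDB : ∀ v, D (B v) = B (D v) + (2 : ℚ) • B v)
    {m : ℕ} {y : M} (hy : D y = (-m : ℚ) • y) :
    ∃ v, D v = (m : ℚ) • v ∧ (A ^ m) v = y := by
  have hup : ∀ v, D v = (-m : ℚ) • v → D ((B ^ m) v) = (m : ℚ) • (B ^ m) v := fun v hv => by
    have := weight_pow_apply (A := B) (D := -D) (μ := m) (v := v)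
      (fun v => by simp only [LinearMap.neg_apply, map_neg, hDB]; module)
      (by rw [LinearMap.neg_apply, hv]; module) m
    rw [LinearMap.neg_apply, neg_eq_iff_eq_neg] at this
    rw [this]
    module
  have hdown : ∀ v, D v = (m : ℚ) • v → D ((A ^ m) v) = (-m : ℚ) • (A ^ m) v := fun v hv => by
    rw [weight_pow_apply hDA hv]
    module
  have hinj : ∀ v, D v = (-m : ℚ) • v → (B ^ m) v = 0 → v = 0 := fun v hv h =>
    eq_zero_of_pow_apply_eq_zero_of_weight (A := B) (B := A) (D := -D)
      (fun v => by simp [hBA])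
      (fun v => by simp only [LinearMap.neg_apply, map_neg, hDB]; module)
      (fun v => by simp only [LinearMap.neg_apply, map_neg, hDA]; module)
      (by rw [LinearMap.neg_apply, hv]; module) h
  let F : Module.End ℚ (D.eigenspace (-m : ℚ)) := (A ^ m * B ^ m).restrict fun v hv => by
    rw [Module.End.mem_eigenspace_iff] at hv ⊢
    exact hdown _ (hup v hv)
  have hF : Function.Injective F := by
    rw [← LinearMap.ker_eq_bot, LinearMap.ker_eq_bot']
    rintro ⟨v, hv⟩ h
    rw [Module.End.mem_eigenspace_iff] at hv
    have h' : (A ^ m) ((B ^ m) v) = 0 := congrArg Subtype.val h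
    exact Subtype.ext (hinj v hv (eq_zero_of_pow_apply_eq_zero_of_weight hBA hDA hDB (hup v hv) h'))
  obtain ⟨⟨z, hz⟩, hzy⟩ :=
    LinearMap.injective_iff_surjective.1 hF ⟨y, Module.End.mem_eigenspace_iff.2 hy⟩
  exact ⟨(B ^ m) z, hup z (Module.End.mem_eigenspace_iff.1 hz), congrArg Subtype.val hzy⟩

end Lefschetz

section Trace

variable {V : Type*} [AddCommGroup V] [Module ℚ V] [FiniteDimensional ℚ V]

theorem eq_zero_of_trace_mul_eq_zero {z : Module.End ℚ V}
    (hz : ∀ f, LinearMap.trace ℚ V (z * f) = 0) : z = 0 := by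
  ext v
  rw [LinearMap.zero_apply, ← Module.forall_dual_apply_eq_zero_iff ℚ]
  intro ψ
  have h := hz (ψ.smulRight v)
  rwa [show z * ψ.smulRight v = ψ.smulRight (z v) by ext x; simp,
    LinearMap.trace_smulRight] at h

/-- Every linear functional on `End V` is of the form `f ↦ tr (z f)`. -/
theorem exists_trace_mul_eq (φ : Module.End ℚ V →ₗ[ℚ] ℚ) :
    ∃ z : Module.End ℚ V, ∀ f, φ f = LinearMap.trace ℚ V (z * f) := by
  let Φ : Module.End ℚ V →ₗ[ℚ] Module.Dual ℚ (Module.End ℚ V) :=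
    LinearMap.compr₂ (LinearMap.mul ℚ (Module.End ℚ V)) (LinearMap.trace ℚ V)
  have hinj : Function.Injective Φ := by
    rw [← LinearMap.ker_eq_bot, LinearMap.ker_eq_bot']
    exact fun z hz => eq_zero_of_trace_mul_eq_zero fun f => LinearMap.congr_fun hz f
  obtain ⟨z, hz⟩ := (LinearMap.injective_iff_surjective_of_finrank_eq_finrank
    (Subspace.dual_finrank_eq (K := ℚ)).symm).1 hinj φ
  exact ⟨z, fun f => by rw [← hz]; rfl⟩

/-- An endomorphism orthogonal, for the trace form, to the centralizer of `N` is a commutator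
with `N`. -/
theorem exists_commutator_eq_of_trace {N H : Module.End ℚ V}
    (h : ∀ z, Commute z N → LinearMap.trace ℚ V (z * H) = 0) :
    ∃ E : Module.End ℚ V, E * N - N * E = H := by
  by_contra hne
  have hH : H ∉ LinearMap.range (adE N) := by
    rintro ⟨E, hE⟩
    exact hne ⟨-E, by rw [← hE, adE_apply]; noncomm_ring⟩
  obtain ⟨φ, hφH, hφ⟩ := Submodule.exists_le_ker_of_notMem hH
  obtain ⟨z, hz⟩ := exists_trace_mul_eq φ
  refine hφH ?_
  rw [hz]
  refine h z ?_
  refine sub_eq_zero.1 (eq_zero_of_trace_mul_eq_zero fun f => ?_)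
  have h1 : φ (adE N f) = 0 := hφ ⟨f, rfl⟩
  rw [hz, adE_apply, mul_sub, map_sub, ← mul_assoc z f N,
    LinearMap.trace_mul_comm ℚ (z * f)] at h1
  rw [sub_mul, map_sub, mul_assoc z, mul_assoc N]
  exact h1

end Trace

section EndLefschetz

variable {V : Type*} [AddCommGroup V] [Module ℚ V]
variable {p p' : ℤ → Module.End ℚ V} {S S' : Finset ℤ} {W W' : ℤ → Submodule ℚ V}

theorem IsHomog.pow {a : ℤ} {f : Module.End ℚ V} (hf : IsHomog p a f) (k : ℕ) :
    IsHomog p (k * a) (f ^ k) := by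
  induction k with
  | zero => simpa using IsHomog.one
  | succ k ih =>
    rw [pow_succ]
    convert ih.mul hf using 1
    push_cast
    ring

theorem IsResolution.weightComp_adE_pow_of_isHomog (hp : IsResolution p S) {a b : ℤ}
    {N : Module.End ℚ V} (hN : IsHomog p a N) (f : Module.End ℚ V) (k : ℕ) :
    weightComp p S (k * a + b) ((adE N ^ k) f) = (adE N ^ k) (weightComp p S b f) := by
  induction k with
  | zero => simp
  | succ k ih =>
    rw [pow_succ', Module.End.mul_apply, Module.End.mul_apply, ← ih, adE_apply, adE_apply,
      map_sub, ← hp.weightComp_mul_left _ hN, ← hp.weightComp_mul_right _ hN]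
    congr 3 <;> (push_cast; ring)

theorem weightComp_pow (hp : IsResolution p S) (hs : IsFiltSplitting p W) (hW : Monotone W)
    {N : Module.End ℚ V} (hN : N ∈ endFilt W 0) (k : ℕ) :
    N ^ k ∈ endFilt W 0 ∧ weightComp p S 0 (N ^ k) = weightComp p S 0 N ^ k := by
  induction k with
  | zero => exact ⟨one_mem_endFilt, by simpa using hp.weightComp_of_isHomog IsHomog.one⟩
  | succ k ih =>
    rw [pow_succ, pow_succ, ← ih.2]
    exact ⟨by simpa using mul_mem_endFilt ih.1 hN,
      by simpa using weightComp_mul hp hs hW ih.1 hN⟩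

theorem pow_sub_weightComp_pow_mem (hp : IsResolution p S) (hs : IsFiltSplitting p W)
    (hW : Monotone W) {N : Module.End ℚ V} (hN : N ∈ endFilt W 0) (k : ℕ) :
    N ^ k - weightComp p S 0 N ^ k ∈ endFilt W (-1) := by
  obtain ⟨h1, h2⟩ := weightComp_pow hp hs hW hN k
  rw [← h2]
  exact sub_weightComp_mem hp hs hW h1

theorem apply_apply_eq_zero_of_mem_grSub (hs : IsFiltSplitting p W) (hs' : IsFiltSplitting p' W')
    (hc : ∀ m n, Commute (p m) (p' n)) {w n b : ℤ} (hb : n < b) {x : V}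
    (hx : x ∈ grSub W W' w n) : p w (p' b x) = 0 := by
  obtain ⟨y, hy, z, hz, rfl⟩ := Submodule.mem_sup.1 hx
  rw [map_add, map_add, hs'.apply_eq_zero n b hb y hy.1, map_zero, zero_add,
    ← Module.End.mul_apply, (hc w b).eq, Module.End.mul_apply,
    hs.apply_eq_zero (w - 1) w (by omega) z hz, map_zero]

theorem IsRelMonFil.eq_zero_of_pow_apply (hp : IsResolution p S) (hs : IsFiltSplitting p W)
    (hW : Monotone W) (hs' : IsFiltSplitting p' W')
    (hc : ∀ m n, Commute (p m) (p' n)) {N : Module.End ℚ V} (hN : N ∈ endFilt W 0)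
    (h : IsRelMonFil N W W') {w : ℤ} {m : ℕ} {x : V} (hx : p w x = x) (hx' : p' (w + m) x = x)
    (h0 : (weightComp p S 0 N ^ m) x = 0) : x = 0 := by
  have hxW : x ∈ W w := hx ▸ hs.apply_mem w x
  have hxW' : x ∈ W' (w + m) := hx' ▸ hs'.apply_mem (w + m) x
  have h1 := pow_sub_weightComp_pow_mem hp hs hW hN m w x hxW
  rw [LinearMap.sub_apply, h0, sub_zero] at h1
  have h2 := (h.2.2 w m).2.2.1 x (Submodule.mem_sup_left ⟨hxW', hxW⟩) (Submodule.mem_sup_right h1)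
  have h3 := apply_apply_eq_zero_of_mem_grSub hs hs' hc (show w + m - 1 < w + m by omega) h2
  rwa [hx', hx] at h3

theorem IsRelMonFil.exists_pow_apply_eq (hp : IsResolution p S) (hs : IsFiltSplitting p W)
    (hW : Monotone W) (hp' : IsResolution p' S') (hs' : IsFiltSplitting p' W')
    (hc : ∀ m n, Commute (p m) (p' n)) {N : Module.End ℚ V} (hN : N ∈ endFilt W 0)
    (hN' : IsHomog p' (-2) N) (h : IsRelMonFil N W W') {w : ℤ} {m : ℕ} {y : V}
    (hy : p w y = y) (hy' : p' (w - m) y = y) :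
    ∃ x, (weightComp p S 0 N ^ m) (p w (p' (w + m) x)) = y := by
  have hyW : y ∈ W w := hy ▸ hs.apply_mem w y
  have hyW' : y ∈ W' (w - m) := hy' ▸ hs'.apply_mem (w - m) y
  obtain ⟨_, ⟨x, hx, rfl⟩, z, hz, hxz⟩ := Submodule.mem_sup.1
    ((h.2.2 w m).2.2.2 (Submodule.mem_sup_left ⟨hyW', hyW⟩))
  obtain ⟨x₁, hx₁, x₂, hx₂, rfl⟩ := Submodule.mem_sup.1 hx
  have hlow : ∀ u ∈ W (w - 1), p w u = 0 := hs.apply_eq_zero (w - 1) w (by omega)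
  have hz0 := apply_apply_eq_zero_of_mem_grSub hs hs' hc (show w - m - 1 < w - m by omega) hz
  have hNx₂ : p w ((N ^ m) x₂) = 0 :=
    hlow _ (by simpa using (weightComp_pow hp hs hW hN m).1 _ x₂ hx₂)
  have hNx₁ : p w ((N ^ m) x₁) = p w ((weightComp p S 0 N ^ m) x₁) := by
    rw [← sub_eq_zero, ← map_sub]
    exact hlow _ (pow_sub_weightComp_pow_mem hp hs hW hN m w x₁ hx₁.2)
  have hswap : ∀ u, p w (p' (w - m) u) = p' (w - m) (p w u) := fun u => by
    rw [← Module.End.mul_apply, (hc w (w - m)).eq, Module.End.mul_apply]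
  have hp0 : p w * weightComp p S 0 N ^ m = weightComp p S 0 N ^ m * p w :=
    ((isHomog_zero_iff.1 (hp.isHomog_weightComp 0 N) w).pow_left m).eq.symm
  have hp'0 : p' (w - m) * weightComp p S 0 N ^ m = weightComp p S 0 N ^ m * p' (w + m) := by
    rw [(hp'.isHomog_weightComp_of_isHomog hc hN' 0).pow m (w + m)]
    congr 2
    ring
  refine ⟨x₁, ?_⟩
  calc (weightComp p S 0 N ^ m) (p w (p' (w + m) x₁))
      = (weightComp p S 0 N ^ m * p w * p' (w + m)) x₁ := rfl
    _ = (p w * p' (w - m) * weightComp p S 0 N ^ m) x₁ := by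
        rw [← hp0, mul_assoc, ← hp'0, mul_assoc]
    _ = p w (p' (w - m) ((N ^ m) (x₁ + x₂) + z)) := by
        rw [map_add (p' (w - m)), map_add (p w), hz0, add_zero, hswap, map_add (N ^ m),
          map_add (p w), hNx₁, hNx₂, add_zero, ← hswap]
        rfl
    _ = y := by rw [hxz, hy', hy]

theorem trace_mul_eq_trace_mul [FiniteDimensional ℚ V] {P Q T z : Module.End ℚ V}
    (hP : P * P = P) (hQ : Q * Q = Q) (hT : T * P = Q * T)
    (hinj : ∀ x, P x = x → T x = 0 → x = 0) (hsurj : ∀ y, ∃ x, T (P x) = Q y)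
    (hz : Commute z T) :
    LinearMap.trace ℚ V (z * P) = LinearMap.trace ℚ V (z * Q) := by
  obtain ⟨s, hs⟩ := Module.projective_lifting_property (T * P).rangeRestrict
    (Q.codRestrict (LinearMap.range (T * P)) hsurj) (T * P).surjective_rangeRestrict
  have hs' : T * P * s = Q := by
    ext y
    exact congrArg Subtype.val (LinearMap.congr_fun hs y)
  have hR : P * s * T * P = P := by
    ext x
    rw [← sub_eq_zero, ← LinearMap.sub_apply]
    refine hinj _ ?_ ?_
    · rw [← Module.End.mul_apply]
      congr 1
      rw [mul_sub, hP]
      simp only [← mul_assoc, hP]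
    · rw [← Module.End.mul_apply]
      have : T * (P * s * T * P - P) = 0 := by
        rw [mul_sub, sub_eq_zero]
        simp only [← mul_assoc]
        rw [hs', ← hT, mul_assoc, hP]
      rw [this, LinearMap.zero_apply]
  calc LinearMap.trace ℚ V (z * P) = LinearMap.trace ℚ V (z * (P * s * Q) * T) := by
        conv_lhs => rw [← hR]
        simp only [mul_assoc, hT]
    _ = LinearMap.trace ℚ V (z * (T * P * s * Q)) := by
        rw [LinearMap.trace_mul_comm, ← mul_assoc, ← hz.eq]
        simp only [mul_assoc]
    _ = _ := by rw [hs', hQ]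

end EndLefschetz

section SlTwo

/-- The operator acting by multiplication by `m` on the part of weight `m`. -/
def weightOp {R : Type*} [Ring R] (p : ℤ → R) (S : Finset ℤ) : R := ∑ m ∈ S, m • p m

theorem IsHomog.weightOp_mul_sub {R : Type*} [Ring R] {p : ℤ → R} {S : Finset ℤ} {a : ℤ} {f : R}
    (hf : IsHomog p a f) (hp : IsResolution p S) :
    weightOp p S * f - f * weightOp p S = a • f := by
  have hY : ∀ m, weightOp p S * p m = m • p m := fun m => by
    simp only [weightOp, zsmul_eq_mul]
    exact hp.sum_mul_single (fun m : ℤ => (m : R)) m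
  refine hp.ext_right fun m => ?_
  rw [sub_mul, mul_assoc, mul_assoc, hY, hf m, ← mul_assoc, hY, mul_smul_comm, hf m,
    smul_mul_assoc, smul_mul_assoc, hf m, add_smul, add_sub_cancel_left]

variable {V : Type*} [AddCommGroup V] [Module ℚ V]

theorem adE_adE_eq (X Y f : Module.End ℚ V) :
    adE X (adE Y f) = adE Y (adE X f) + adE (X * Y - Y * X) f := by
  simp only [adE_apply]
  noncomm_ring

theorem adE_smul (c : ℚ) (X f : Module.End ℚ V) : adE (c • X) f = c • adE X f := by
  rw [adE_apply, adE_apply, smul_mul_assoc, mul_smul_comm, smul_sub]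

/-- The commuting gradings given by `p` and `p'` split the filtration `W` preserved by `N` and the
relative monodromy filtration `W'`, and `N` has degree `-2` for `p'`. -/
structure IsBisplitting (N : Module.End ℚ V) (W W' : ℤ → Submodule ℚ V)
    (p p' : ℤ → Module.End ℚ V) (S S' : Finset ℤ) : Prop where
  monotone : Monotone W
  relMonFil : IsRelMonFil N W W'
  mem_endFilt : N ∈ endFilt W 0
  isResolution : IsResolution p S
  isFiltSplitting : IsFiltSplitting p W
  isResolution' : IsResolution p' S'
  isFiltSplitting' : IsFiltSplitting p' W'
  isHomog' : IsHomog p' (-2) N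
  commute : ∀ m n, Commute (p m) (p' n)

namespace IsBisplitting

variable {p p' : ℤ → Module.End ℚ V} {S S' : Finset ℤ} {W W' : ℤ → Submodule ℚ V}
variable {N : Module.End ℚ V}

theorem isHomog_weightComp (h : IsBisplitting N W W' p p' S S') (w : ℤ) :
    IsHomog p w (weightComp p S w N) := h.isResolution.isHomog_weightComp w N

theorem isHomog'_weightComp (h : IsBisplitting N W W' p p' S S') (w : ℤ) :
    IsHomog p' (-2) (weightComp p S w N) :=
  h.isResolution'.isHomog_weightComp_of_isHomog h.commute h.isHomog' w

theorem trace_mul_add_eq_sub [FiniteDimensional ℚ V] (h : IsBisplitting N W W' p p' S S')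
    {z : Module.End ℚ V} (hz : Commute z (weightComp p S 0 N)) (w : ℤ) (m : ℕ) :
    LinearMap.trace ℚ V (z * (p w * p' (w + m))) =
      LinearMap.trace ℚ V (z * (p w * p' (w - m))) := by
  have hid : ∀ n, p w * p' n * (p w * p' n) = p w * p' n := fun n => by
    rw [(h.commute w n).symm.mul_mul_mul_comm, h.isResolution.mul_self, h.isResolution'.mul_self]
  have hp0 : p w * weightComp p S 0 N ^ m = weightComp p S 0 N ^ m * p w :=
    ((isHomog_zero_iff.1 (h.isHomog_weightComp 0) w).pow_left m).eq.symm
  have hp'0 : p' (w - m) * weightComp p S 0 N ^ m = weightComp p S 0 N ^ m * p' (w + m) := by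
    rw [(h.isHomog'_weightComp 0).pow m (w + m)]
    congr 2
    ring
  have hblock : ∀ n x, p w (p' n x) = x → p w x = x ∧ p' n x = x := fun n x hx => by
    refine ⟨?_, ?_⟩
    · rw [← hx, ← Module.End.mul_apply, h.isResolution.mul_self]
    · rw [← Module.End.mul_apply, (h.commute w n).eq] at hx
      rw [← hx, ← Module.End.mul_apply, ← mul_assoc, h.isResolution'.mul_self]
  refine trace_mul_eq_trace_mul (T := weightComp p S 0 N ^ m) (hid _) (hid _) ?_ ?_ ?_
    (hz.pow_right m)
  · rw [← mul_assoc, ← hp0, mul_assoc, ← hp'0, mul_assoc]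
  · intro x hx hx0
    obtain ⟨h1, h2⟩ := hblock _ _ hx
    exact h.relMonFil.eq_zero_of_pow_apply h.isResolution h.isFiltSplitting h.monotone
      h.isFiltSplitting' h.commute h.mem_endFilt h1 h2 hx0
  · intro y
    obtain ⟨h1, h2⟩ := hblock (w - m) ((p w * p' (w - m)) y)
      (by rw [← Module.End.mul_apply, ← Module.End.mul_apply, hid])
    exact h.relMonFil.exists_pow_apply_eq h.isResolution h.isFiltSplitting h.monotone
      h.isResolution' h.isFiltSplitting' h.commute h.mem_endFilt h.isHomog' h1 h2

theorem trace_mul_weightOp_sub [FiniteDimensional ℚ V] (h : IsBisplitting N W W' p p' S S')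
    {z : Module.End ℚ V} (hz : Commute z (weightComp p S 0 N)) :
    LinearMap.trace ℚ V (z * (weightOp p' S' - weightOp p S)) = 0 := by
  have hexp : weightOp p' S' - weightOp p S = ∑ w ∈ S, ∑ n ∈ S', (n - w) • (p w * p' n) := by
    rw [← one_mul (weightOp p' S'), ← h.isResolution.sum_eq_one, ← mul_one (weightOp p S),
      ← h.isResolution'.sum_eq_one, weightOp, weightOp, Finset.sum_mul_sum, Finset.sum_mul_sum,
      ← Finset.sum_sub_distrib]
    refine Finset.sum_congr rfl fun w _ => ?_
    rw [← Finset.sum_sub_distrib]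
    refine Finset.sum_congr rfl fun n _ => ?_
    rw [mul_smul_comm, smul_mul_assoc, sub_smul]
  rw [hexp, Finset.mul_sum, map_sum]
  refine Finset.sum_eq_zero fun w _ => ?_
  set t : ℤ → ℚ := fun n => LinearMap.trace ℚ V (z * (p w * p' n)) with ht
  have hsymm : ∀ n, t (2 * w - n) = t n := fun n => by
    rcases le_total w n with hn | hn
    · have := h.trace_mul_add_eq_sub hz w (n - w).toNat
      rw [Int.toNat_of_nonneg (by omega), show w + (n - w) = n by ring,
        show w - (n - w) = 2 * w - n by ring] at this
      exact this.symm
    · have := h.trace_mul_add_eq_sub hz w (w - n).toNat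
      rwa [Int.toNat_of_nonneg (by omega), show w - (w - n) = n by ring,
        show w + (w - n) = 2 * w - n by ring] at this
  have hoff : ∀ n, t n ≠ 0 → n ∈ S' := fun n hn => by
    by_contra hnS
    exact hn (by simp [ht, h.isResolution'.zero_off n hnS])
  have hsum : LinearMap.trace ℚ V (z * ∑ n ∈ S', (n - w) • (p w * p' n)) =
      ∑ n ∈ S', ((n - w : ℤ) : ℚ) * t n := by
    rw [Finset.mul_sum, map_sum]
    refine Finset.sum_congr rfl fun n _ => ?_
    rw [mul_smul_comm, map_zsmul, zsmul_eq_mul]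
  rw [hsum, ← Finset.sum_filter_ne_zero]
  refine Finset.sum_involution (fun n _ => 2 * w - n) (fun n _ => ?_) (fun n _ hn h' => ?_)
    (fun n hn => ?_) (fun n _ => by ring)
  · rw [hsymm]
    push_cast
    ring
  · obtain rfl : n = w := by omega
    simp at hn
  · rw [Finset.mem_filter] at hn ⊢
    have hne := hn.2
    rw [mul_ne_zero_iff] at hne
    refine ⟨hoff _ (by rw [hsymm]; exact hne.2), ?_⟩
    rw [hsymm]
    refine mul_ne_zero ?_ hne.2
    have := hne.1
    simp only [ne_eq, Int.cast_eq_zero] at this ⊢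
    omega

theorem exists_raising [FiniteDimensional ℚ V] (h : IsBisplitting N W W' p p' S S') :
    ∃ E : Module.End ℚ V, IsHomog p 0 E ∧ IsHomog p' 2 E ∧
      E * weightComp p S 0 N - weightComp p S 0 N * E = weightOp p' S' - weightOp p S := by
  obtain ⟨E, hE⟩ := exists_commutator_eq_of_trace fun z hz => h.trace_mul_weightOp_sub hz
  refine ⟨weightComp p S 0 (weightComp p' S' 2 E), h.isResolution.isHomog_weightComp _ _,
    h.isResolution'.isHomog_weightComp_of_isHomog h.commute
      (h.isResolution'.isHomog_weightComp _ _) _, ?_⟩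
  have hop : IsHomog p 0 (weightOp p' S' - weightOp p S) ∧
      IsHomog p' 0 (weightOp p' S' - weightOp p S) := by
    have hpp : ∀ {q : ℤ → Module.End ℚ V} {T : Finset ℤ}, IsResolution q T →
        ∀ m n, Commute (q m) (q n) := fun {q T} hq m n => by
      rcases eq_or_ne m n with rfl | hmn
      · exact Commute.refl _
      · rw [Commute, SemiconjBy, hq.mul_ne _ _ hmn, hq.mul_ne _ _ hmn.symm]
    constructor <;> refine isHomog_zero_iff.2 fun m => Commute.sub_left ?_ ?_ <;>
      refine Commute.sum_left _ _ _ fun n _ => Commute.smul_left ?_ n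
    · exact (h.commute m n).symm
    · exact hpp h.isResolution n m
    · exact hpp h.isResolution' n m
    · exact h.commute n m
  generalize weightOp p' S' - weightOp p S = H at hE hop ⊢
  have h1 := h.isResolution'.weightComp_mul_right (a := 2) E (h.isHomog'_weightComp 0)
  have h2 := h.isResolution'.weightComp_mul_left (a := 2) E (h.isHomog'_weightComp 0)
  have h3 := h.isResolution.weightComp_mul_right (a := 0) (weightComp p' S' 2 E)
    (h.isHomog_weightComp 0)
  have h4 := h.isResolution.weightComp_mul_left (a := 0) (weightComp p' S' 2 E)
    (h.isHomog_weightComp 0)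
  rw [← h3, ← h4, ← h1, ← h2, ← map_sub (weightComp p S (0 + 0)), add_neg_cancel, neg_add_cancel,
    ← map_sub, hE, h.isResolution'.weightComp_of_isHomog hop.2,
    add_zero, h.isResolution.weightComp_of_isHomog hop.1]

theorem exists_sl2_triple [FiniteDimensional ℚ V] (h : IsBisplitting N W W' p p' S S') :
    ∃ B D : Module.End ℚ (Module.End ℚ V),
      (∀ v, B (adE (weightComp p S 0 N) v) = adE (weightComp p S 0 N) (B v) + D v) ∧
      (∀ v, D (adE (weightComp p S 0 N) v) =
        adE (weightComp p S 0 N) (D v) - (2 : ℚ) • adE (weightComp p S 0 N) v) ∧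
      (∀ v, D (B v) = B (D v) + (2 : ℚ) • B v) ∧
      ∀ a b f, IsHomog p a f → IsHomog p' b f → D f = ((b - a : ℤ) : ℚ) • f := by
  obtain ⟨E, hE, hE', hEN⟩ := h.exists_raising
  have hD : ∀ a b f, IsHomog p a f → IsHomog p' b f →
      adE (weightOp p' S' - weightOp p S) f = ((b - a : ℤ) : ℚ) • f := fun a b f hf hf' => by
    rw [Int.cast_smul_eq_zsmul, sub_smul, ← hf.weightOp_mul_sub h.isResolution,
      ← hf'.weightOp_mul_sub h.isResolution', adE_apply]
    noncomm_ring
  refine ⟨adE E, adE (weightOp p' S' - weightOp p S), fun v => ?_, fun v => ?_, fun v => ?_, hD⟩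
  · rw [adE_adE_eq, hEN]
  · rw [adE_adE_eq, ← adE_apply _ (weightComp p S 0 N),
      hD 0 (-2) _ (h.isHomog_weightComp 0) (h.isHomog'_weightComp 0), adE_smul]
    push_cast
    module
  · rw [adE_adE_eq, ← adE_apply _ E, hD 0 2 _ hE hE', adE_smul]
    push_cast
    module

/-- `Ad(N₀)^k` is injective on the endomorphisms of bidegree `(-k, 0)`. -/
theorem eq_zero_of_adE_pow_apply [FiniteDimensional ℚ V] (h : IsBisplitting N W W' p p' S S')
    {k : ℕ} {γ : Module.End ℚ V} (hγ : IsHomog p (-k) γ) (hγ' : IsHomog p' 0 γ)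
    (h0 : (adE (weightComp p S 0 N) ^ k) γ = 0) : γ = 0 := by
  obtain ⟨B, D, hBA, hDA, hDB, hD⟩ := h.exists_sl2_triple
  refine eq_zero_of_pow_apply_eq_zero_of_weight hBA hDA hDB (m := k) ?_ h0
  rw [hD _ _ _ hγ hγ']
  push_cast
  rw [zero_sub, neg_neg]

/-- `Ad(N₀)^k` maps onto the endomorphisms of bidegree `(-k, -2k)`. -/
theorem exists_adE_pow_apply_eq [FiniteDimensional ℚ V] (h : IsBisplitting N W W' p p' S S')
    {k : ℕ} {y : Module.End ℚ V} (hy : IsHomog p (-k) y) (hy' : IsHomog p' (k * -2) y) :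
    ∃ γ, IsHomog p (-k) γ ∧ IsHomog p' 0 γ ∧ (adE (weightComp p S 0 N) ^ k) γ = y := by
  obtain ⟨B, D, hBA, hDA, hDB, hD⟩ := h.exists_sl2_triple
  obtain ⟨γ, -, hγ⟩ := exists_pow_apply_eq_of_weight hBA hDA hDB (m := k) (y := y) (by
    rw [hD _ _ _ hy hy']
    push_cast
    module)
  refine ⟨weightComp p S (-k) (weightComp p' S' 0 γ), h.isResolution.isHomog_weightComp _ _,
    h.isResolution'.isHomog_weightComp_of_isHomog h.commute
      (h.isResolution'.isHomog_weightComp _ _) _, ?_⟩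
  rw [← h.isResolution.weightComp_adE_pow_of_isHomog (h.isHomog_weightComp 0),
    ← h.isResolution'.weightComp_adE_pow_of_isHomog (h.isHomog'_weightComp 0), hγ, add_zero,
    mul_zero, zero_add, h.isResolution'.weightComp_of_isHomog hy',
    h.isResolution.weightComp_of_isHomog hy]

end IsBisplitting

end SlTwo

section Gauge

variable {V : Type*} [AddCommGroup V] [Module ℚ V]
variable {p p' : ℤ → Module.End ℚ V} {S S' : Finset ℤ} {W W' : ℤ → Submodule ℚ V}

theorem IsFiniteFiltration.exists_endFilt_eq_zero (hW : IsFiniteFiltration W) :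
    ∃ n : ℕ, ∀ f ∈ endFilt W (-n), f = 0 := by
  obtain ⟨-, ⟨a, ha⟩, ⟨b, hb⟩⟩ := hW
  refine ⟨(b - a).toNat, fun f hf => ?_⟩
  ext x
  have := hf b x (by rw [hb b le_rfl]; trivial)
  rwa [ha _ (by omega), Submodule.mem_bot] at this

theorem pow_mem_endFilt_neg {f : Module.End ℚ V} (hf : f ∈ endFilt W (-1)) (n : ℕ) :
    f ^ n ∈ endFilt W (-n) := by
  induction n with
  | zero => simpa using one_mem_endFilt
  | succ n ih =>
    rw [pow_succ]
    convert mul_mem_endFilt ih hf using 1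
    push_cast
    ring_nf

theorem inv_mem_endFilt [FiniteDimensional ℚ V] {u : (Module.End ℚ V)ˣ}
    (hu : (u : Module.End ℚ V) ∈ endFilt W 0) : (↑u⁻¹ : Module.End ℚ V) ∈ endFilt W 0 := by
  intro w x hx
  have hinv : ∀ y, (↑u⁻¹ : Module.End ℚ V) ((u : Module.End ℚ V) y) = y := fun y => by
    rw [← Module.End.mul_apply, Units.inv_mul, Module.End.one_apply]
  have hmap : (W w).map (u : Module.End ℚ V) = W w := by
    refine Submodule.eq_of_le_of_finrank_eq ?_ ?_
    · rintro _ ⟨y, hy, rfl⟩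
      simpa using hu w y hy
    · exact (Submodule.equivMapOfInjective _
        (Function.LeftInverse.injective hinv) _).finrank_eq.symm
  rw [← hmap] at hx
  obtain ⟨y, hy, rfl⟩ := hx
  rw [hinv]
  simpa using hy

/-- `u` is an automorphism of bidegree `(≤ 0, 0)` inducing the identity on `gr^W`. -/
structure IsGauge (W : ℤ → Submodule ℚ V) (p' : ℤ → Module.End ℚ V)
    (u : (Module.End ℚ V)ˣ) : Prop where
  sub_one_mem : (u : Module.End ℚ V) - 1 ∈ endFilt W (-1)
  isHomog : IsHomog p' 0 (u : Module.End ℚ V)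

theorem exists_isGauge_eq_one_add (hW : IsFiniteFiltration W) {f : Module.End ℚ V}
    (hf : f ∈ endFilt W (-1)) (hf' : IsHomog p' 0 f) :
    ∃ u : (Module.End ℚ V)ˣ, IsGauge W p' u ∧ (u : Module.End ℚ V) = 1 + f := by
  obtain ⟨n, hn⟩ := hW.exists_endFilt_eq_zero
  have hnil : IsNilpotent f := ⟨n, hn _ (pow_mem_endFilt_neg hf n)⟩
  obtain ⟨u, hu⟩ := hnil.isUnit_one_add
  refine ⟨u, ⟨?_, ?_⟩, hu⟩
  · rwa [hu, add_sub_cancel_left]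
  · rw [hu]
    exact IsHomog.one.add hf'

namespace IsGauge

variable {u v : (Module.End ℚ V)ˣ}

theorem mem_endFilt (hu : IsGauge W p' u) (hW : Monotone W) :
    (u : Module.End ℚ V) ∈ endFilt W 0 := by
  have := Submodule.add_mem _ (endFilt_mono hW (by norm_num) hu.sub_one_mem)
    (one_mem_endFilt (W := W))
  simpa using this

theorem inv [FiniteDimensional ℚ V] (hu : IsGauge W p' u) (hW : Monotone W) :
    IsGauge W p' u⁻¹ := by
  refine ⟨?_, isHomog_zero_iff.2 fun m => ?_⟩
  · have h := mul_mem_endFilt (inv_mem_endFilt (hu.mem_endFilt hW)) hu.sub_one_mem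
    rw [mul_sub, Units.inv_mul, mul_one, zero_add] at h
    simpa using Submodule.neg_mem _ h
  · exact (isHomog_zero_iff.1 hu.isHomog m).units_inv_left

theorem mul (hu : IsGauge W p' u) (hv : IsGauge W p' v) (hW : Monotone W) :
    IsGauge W p' (u * v) := by
  refine ⟨?_, hu.isHomog.mul hv.isHomog⟩
  have h := mul_mem_endFilt (hu.mem_endFilt hW) hv.sub_one_mem
  rw [zero_add] at h
  convert Submodule.add_mem _ h hu.sub_one_mem using 1
  rw [Units.val_mul]
  noncomm_ring

theorem weightComp_zero (hu : IsGauge W p' u) (hp : IsResolution p S)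
    (hs : IsFiltSplitting p W) : weightComp p S 0 (u : Module.End ℚ V) = 1 := by
  have h := weightComp_eq_zero_of_mem (S := S) hs (show (-1 : ℤ) < 0 by norm_num) hu.sub_one_mem
  rwa [map_sub, hp.weightComp_of_isHomog IsHomog.one, sub_eq_zero] at h

theorem conj_mem_endFilt [FiniteDimensional ℚ V] (hu : IsGauge W p' u) (hW : Monotone W)
    {f : Module.End ℚ V} (hf : f ∈ endFilt W 0) :
    (↑u⁻¹ : Module.End ℚ V) * f * u ∈ endFilt W 0 := by
  simpa using mul_mem_endFilt (mul_mem_endFilt ((hu.inv hW).mem_endFilt hW) hf) (hu.mem_endFilt hW)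

theorem weightComp_zero_conj [FiniteDimensional ℚ V] (hu : IsGauge W p' u)
    (hp : IsResolution p S) (hs : IsFiltSplitting p W) (hW : Monotone W) {f : Module.End ℚ V}
    (hf : f ∈ endFilt W 0) :
    weightComp p S 0 ((↑u⁻¹ : Module.End ℚ V) * f * u) = weightComp p S 0 f := by
  have hi := (hu.inv hW).mem_endFilt hW
  have h1 := weightComp_mul hp hs hW hi hf
  have h2 := weightComp_mul hp hs hW (mul_mem_endFilt hi hf) (hu.mem_endFilt hW)
  simp only [add_zero] at h1 h2
  rw [h2, h1, (hu.inv hW).weightComp_zero hp hs, hu.weightComp_zero hp hs, one_mul, mul_one]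

theorem isHomog_conj [FiniteDimensional ℚ V] (hu : IsGauge W p' u) (hW : Monotone W) {a : ℤ}
    {f : Module.End ℚ V} (hf : IsHomog p' a f) :
    IsHomog p' a ((↑u⁻¹ : Module.End ℚ V) * f * u) := by
  simpa using ((hu.inv hW).isHomog.mul hf).mul hu.isHomog

end IsGauge

theorem adE_pow_conj (u : (Module.End ℚ V)ˣ) (X f : Module.End ℚ V) (k : ℕ) :
    (adE ((u : Module.End ℚ V) * X * (↑u⁻¹ : Module.End ℚ V)) ^ k)
      ((u : Module.End ℚ V) * f * (↑u⁻¹ : Module.End ℚ V)) =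
        u * (adE X ^ k) f * (↑u⁻¹ : Module.End ℚ V) := by
  induction k with
  | zero => rfl
  | succ k ih =>
    rw [pow_succ', pow_succ', Module.End.mul_apply, Module.End.mul_apply, ih, adE_apply, adE_apply]
    simp [mul_assoc, mul_sub, sub_mul]

theorem hasPrimitiveComps_conj_iff (u : (Module.End ℚ V)ˣ) (N : Module.End ℚ V) :
    HasPrimitiveComps (fun i => (u : Module.End ℚ V) * p i * (↑u⁻¹ : Module.End ℚ V)) S N ↔
      HasPrimitiveComps p S ((↑u⁻¹ : Module.End ℚ V) * N * u) := by
  simp only [HasPrimitiveComps, IsResolution.weightComp_conj, adE_pow_conj, Units.mul_left_eq_zero,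
    Units.mul_right_eq_zero]

namespace IsBisplitting

variable {N : Module.End ℚ V}

theorem conj [FiniteDimensional ℚ V] (h : IsBisplitting N W W' p p' S S')
    {u : (Module.End ℚ V)ˣ} (hu : IsGauge W p' u) :
    IsBisplitting N W W'
      (fun i => (u : Module.End ℚ V) * p i * (↑u⁻¹ : Module.End ℚ V)) p' S S' where
  monotone := h.monotone
  relMonFil := h.relMonFil
  mem_endFilt := h.mem_endFilt
  isResolution := h.isResolution.conj u
  isResolution' := h.isResolution'
  isFiltSplitting' := h.isFiltSplitting'
  isHomog' := h.isHomog'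
  commute m n := ((isHomog_zero_iff.1 hu.isHomog n).mul_left (h.commute m n)).mul_left
    (isHomog_zero_iff.1 (hu.inv h.monotone).isHomog n)
  isFiltSplitting := by
    refine ⟨fun m v => ?_, fun w m hm v hv => ?_⟩
    · simpa using hu.mem_endFilt h.monotone m _ (h.isFiltSplitting.apply_mem m _)
    · have hv' := (hu.inv h.monotone).mem_endFilt h.monotone w v hv
      rw [add_zero] at hv'
      rw [Module.End.mul_apply, Module.End.mul_apply, h.isFiltSplitting.apply_eq_zero w m hm _ hv',
        map_zero]

theorem exists_isGauge_primitive_below [FiniteDimensional ℚ V] (hW : IsFiniteFiltration W)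
    (h : IsBisplitting N W W' p p' S S') (j : ℕ) :
    ∃ u : (Module.End ℚ V)ˣ, IsGauge W p' u ∧ ∀ k < j, (adE (weightComp p S 0 N) ^ k)
      (weightComp p S (-(k + 1)) ((↑u⁻¹ : Module.End ℚ V) * N * u)) = 0 := by
  induction j with
  | zero => exact ⟨1, ⟨by simp, IsHomog.one⟩, fun k hk => absurd hk (Nat.not_lt_zero k)⟩
  | succ j ih =>
    obtain ⟨u, hu, hprim⟩ := ih
    have hM := hu.conj_mem_endFilt h.monotone h.mem_endFilt
    have hM' := hu.isHomog_conj h.monotone h.isHomog'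
    have hM0 := hu.weightComp_zero_conj h.isResolution h.isFiltSplitting h.monotone h.mem_endFilt
    set M := (↑u⁻¹ : Module.End ℚ V) * N * u with hMdef
    obtain ⟨γ, hγ, hγ', hγN⟩ := h.exists_adE_pow_apply_eq (k := j + 1)
      (y := -(adE (weightComp p S 0 N) ^ j) (weightComp p S (-(j + 1)) M))
      (by
        convert ((h.isHomog_weightComp 0).adE_pow
          (h.isResolution.isHomog_weightComp (-(j + 1)) M) j).neg using 1
        push_cast
        ring)
      (by
        convert ((h.isHomog'_weightComp 0).adE_pow
          (h.isResolution'.isHomog_weightComp_of_isHomog h.commute hM' (-(j + 1))) j).neg using 1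
        push_cast
        ring)
    have hγW := hγ.mem_endFilt h.isResolution h.isFiltSplitting h.monotone
    push_cast at hγ hγW
    obtain ⟨v, hv, hvγ⟩ := exists_isGauge_eq_one_add hW
      (endFilt_mono h.monotone (by omega) hγW) hγ'
    refine ⟨u * v, hu.mul hv h.monotone, fun k hk => ?_⟩
    have hdiff : (↑(u * v)⁻¹ : Module.End ℚ V) * N * ↑(u * v) =
        M + (↑v⁻¹ : Module.End ℚ V) * adE M γ := by
      rw [← sub_eq_iff_eq_add', ← Units.mul_right_inj v, Units.mul_inv_cancel_left, mul_sub,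
        mul_inv_rev, Units.val_mul, Units.val_mul]
      rw [show (v : Module.End ℚ V) * (↑v⁻¹ * ↑u⁻¹ * N * (↑u * ↑v)) = M * v by
        simp [hMdef, mul_assoc], hvγ, adE_apply]
      noncomm_ring
    have had : adE M γ ∈ endFilt W (-(j + 1)) := by simpa using adE_mem_endFilt hM hγW
    have hi := (hv.inv h.monotone).mem_endFilt h.monotone
    have hdiffW : (↑v⁻¹ : Module.End ℚ V) * adE M γ ∈ endFilt W (-(j + 1)) := by
      simpa using mul_mem_endFilt hi had
    rw [hdiff, map_add]
    rcases Nat.lt_succ_iff_lt_or_eq.1 hk with hk | rfl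
    · rw [weightComp_eq_zero_of_mem h.isFiltSplitting (by omega) hdiffW, add_zero, hprim k hk]
    · have h1 := weightComp_mul h.isResolution h.isFiltSplitting h.monotone hi had
      have h2 := weightComp_adE h.isResolution h.isFiltSplitting h.monotone hM hγW
      rw [zero_add] at h1 h2
      rw [h1, h2, (hv.inv h.monotone).weightComp_zero h.isResolution h.isFiltSplitting, hM0,
        h.isResolution.weightComp_of_isHomog hγ, one_mul, map_add, ← Module.End.mul_apply _ _ γ,
        ← pow_succ, hγN, add_neg_cancel]

theorem exists_isGauge_hasPrimitiveComps [FiniteDimensional ℚ V] (hW : IsFiniteFiltration W)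
    (h : IsBisplitting N W W' p p' S S') :
    ∃ u : (Module.End ℚ V)ˣ, IsGauge W p' u ∧
      HasPrimitiveComps (fun i => (u : Module.End ℚ V) * p i * (↑u⁻¹ : Module.End ℚ V)) S N := by
  obtain ⟨n, hn⟩ := hW.exists_endFilt_eq_zero
  obtain ⟨u, hu, hprim⟩ := h.exists_isGauge_primitive_below hW n
  refine ⟨u, hu, (hasPrimitiveComps_conj_iff u N).2 fun k => ?_⟩
  rw [hu.weightComp_zero_conj h.isResolution h.isFiltSplitting h.monotone h.mem_endFilt]
  rcases lt_or_ge k n with hk | hk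
  · exact hprim k hk
  · rw [hn (weightComp p S (-(k + 1)) _) (endFilt_mono h.monotone (by omega)
      ((h.isResolution.isHomog_weightComp _ _).mem_endFilt h.isResolution h.isFiltSplitting
        h.monotone)), map_zero]

theorem eq_one_of_isGauge [FiniteDimensional ℚ V] (hW : IsFiniteFiltration W)
    (h : IsBisplitting N W W' p p' S S') {u : (Module.End ℚ V)ˣ} (hu : IsGauge W p' u)
    (hN : HasPrimitiveComps p S N)
    (hN' : HasPrimitiveComps p S ((↑u⁻¹ : Module.End ℚ V) * N * u)) : u = 1 := by
  have key : ∀ j : ℕ, (u : Module.End ℚ V) - 1 ∈ endFilt W (-(j + 1)) := fun j => by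
    induction j with
    | zero => simpa using hu.sub_one_mem
    | succ j ih =>
      have hM := hu.conj_mem_endFilt h.monotone h.mem_endFilt
      have hM0 := hu.weightComp_zero_conj h.isResolution h.isFiltSplitting h.monotone h.mem_endFilt
      have hprim := hN' j
      have huM : (u : Module.End ℚ V) * ((↑u⁻¹ : Module.End ℚ V) * N * u) = N * u := by
        simp [mul_assoc]
      rw [hM0] at hprim
      generalize (↑u⁻¹ : Module.End ℚ V) * N * u = M at hM hM0 hprim huM
      have hdiff : M - N = N * ((u : Module.End ℚ V) - 1) - ((u : Module.End ℚ V) - 1) * M := by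
        rw [sub_mul, huM]
        noncomm_ring
      have h1 := weightComp_mul h.isResolution h.isFiltSplitting h.monotone h.mem_endFilt ih
      have h2 := weightComp_mul h.isResolution h.isFiltSplitting h.monotone ih hM
      rw [zero_add] at h1
      rw [add_zero, hM0] at h2
      have hcomp := congrArg (weightComp p S (-(j + 1))) hdiff
      rw [map_sub _ M, map_sub _ (N * _), h1, h2, ← adE_apply] at hcomp
      replace hcomp := congrArg (adE (weightComp p S 0 N) ^ j) hcomp
      rw [← Module.End.mul_apply, ← pow_succ, map_sub, hprim, hN j, sub_zero] at hcomp
      have hzero := h.eq_zero_of_adE_pow_apply (k := j + 1)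
        (by push_cast; exact h.isResolution.isHomog_weightComp (-(j + 1)) _)
        (h.isResolution'.isHomog_weightComp_of_isHomog h.commute
          (hu.isHomog.sub IsHomog.one) _) hcomp.symm
      convert mem_endFilt_sub_one h.isResolution h.isFiltSplitting h.monotone ih hzero using 2
      push_cast
      ring
  obtain ⟨n, hn⟩ := hW.exists_endFilt_eq_zero
  ext1
  rw [Units.val_one, ← sub_eq_zero]
  exact hn _ (endFilt_mono h.monotone (by omega) (key n))

end IsBisplitting

end Gauge

section Comparison

variable {V : Type*} [AddCommGroup V] [Module ℚ V]
variable {p p' q : ℤ → Module.End ℚ V} {S S' : Finset ℤ} {W W' : ℤ → Submodule ℚ V}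

theorem IsResolution.mono {ι R : Type*} [Ring R] {p : ι → R} {S T : Finset ι}
    (hp : IsResolution p S) (h : S ⊆ T) : IsResolution p T where
  mul_self := hp.mul_self
  mul_ne := hp.mul_ne
  zero_off i hi := hp.zero_off i fun hS => hi (h hS)
  sum_eq_one := hp.sum_superset h

theorem IsFiltSplitting.sub_apply_mem (hs : IsFiltSplitting p W) (hp : IsResolution p S)
    (hW : Monotone W) {m : ℤ} {x : V} (hx : x ∈ W m) : x - p m x ∈ W (m - 1) := by
  rw [← hp.sum_apply (x - p m x)]
  refine Submodule.sum_mem _ fun i _ => ?_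
  rw [map_sub, ← Module.End.mul_apply]
  rcases lt_trichotomy i m with hi | rfl | hi
  · rw [hp.mul_ne i m hi.ne, LinearMap.zero_apply, sub_zero]
    exact hW (by omega) (hs.apply_mem i x)
  · rw [hp.mul_self, sub_self]
    exact Submodule.zero_mem _
  · rw [hp.mul_ne i m hi.ne', hs.apply_eq_zero m i hi x hx, LinearMap.zero_apply, sub_zero]
    exact Submodule.zero_mem _

/-- Two splittings of `W` commuting with `p'` are conjugate. -/
theorem exists_isGauge_conj_eq (hW : IsFiniteFiltration W) (hp : IsResolution p S)
    (hs : IsFiltSplitting p W) (hq : IsResolution q S) (hqs : IsFiltSplitting q W)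
    (hc : ∀ m n, Commute (p m) (p' n)) (hqc : ∀ m n, Commute (q m) (p' n)) :
    ∃ u : (Module.End ℚ V)ˣ, IsGauge W p' u ∧
      q = fun i => (u : Module.End ℚ V) * p i * (↑u⁻¹ : Module.End ℚ V) := by
  set g : Module.End ℚ V := ∑ m ∈ S, q m * p m with hg
  have hgp : ∀ m, g * p m = q m * p m := hp.sum_mul_single q
  have hqg : ∀ m, q m * g = q m * p m := hq.single_mul_sum p
  have hgW : g ∈ endFilt W 0 := fun w x hx => by
    rw [hg, LinearMap.sum_apply, add_zero]
    refine Submodule.sum_mem _ fun m _ => ?_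
    rw [Module.End.mul_apply]
    rcases lt_or_ge w m with hm | hm
    · rw [hs.apply_eq_zero w m hm x hx, map_zero]
      exact Submodule.zero_mem _
    · exact hW.1 hm (hqs.apply_mem m _)
  have hg0 : weightComp p S 0 (g - 1) = 0 := by
    rw [map_sub, sub_eq_zero, hp.weightComp_of_isHomog IsHomog.one]
    refine hp.ext_right fun m => ?_
    rw [hp.weightComp_mul_single, add_zero, mul_assoc, hgp, one_mul]
    ext v
    have := hs.apply_eq_zero (m - 1) m (by omega) _
      (hqs.sub_apply_mem hq hW.1 (hs.apply_mem m v))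
    rw [map_sub, sub_eq_zero] at this
    rw [Module.End.mul_apply, Module.End.mul_apply, ← this, ← Module.End.mul_apply, hp.mul_self]
  have hg1 : g - 1 ∈ endFilt W (-1) :=
    mem_endFilt_sub_one hp hs hW.1 (Submodule.sub_mem _ hgW one_mem_endFilt) hg0
  have hgh : IsHomog p' 0 (g - 1) := isHomog_zero_iff.2 fun n =>
    (Commute.sum_left _ _ _ fun m _ => (hqc m n).mul_left (hc m n)).sub_left (Commute.one_left _)
  obtain ⟨u, hu, hug⟩ := exists_isGauge_eq_one_add hW hg1 hgh
  rw [add_sub_cancel] at hug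
  refine ⟨u, hu, funext fun m => ?_⟩
  rw [hug, hgp, ← hqg, ← hug, Units.mul_inv_cancel_right]

theorem IsBisplitting.eq_of_hasPrimitiveComps [FiniteDimensional ℚ V] {N : Module.End ℚ V}
    (hW : IsFiniteFiltration W) (hp : IsBisplitting N W W' p p' S S')
    (hq : IsBisplitting N W W' q p' S S') (hpN : HasPrimitiveComps p S N)
    (hqN : HasPrimitiveComps q S N) : q = p := by
  obtain ⟨u, hu, rfl⟩ := exists_isGauge_conj_eq hW hp.isResolution hp.isFiltSplitting
    hq.isResolution hq.isFiltSplitting hp.commute hq.commute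
  obtain rfl := hp.eq_one_of_isGauge hW hu hpN ((hasPrimitiveComps_conj_iff u N).1 hqN)
  simp

end Comparison

section ExistsSplitting

variable {V : Type*} [AddCommGroup V] [Module ℚ V]
variable {p' : ℤ → Module.End ℚ V} {S' : Finset ℤ} {W : ℤ → Submodule ℚ V}

theorem exists_projection_commute (hp' : IsResolution p' S') {A : Submodule ℚ V}
    (hA : ∀ n, ∀ x ∈ A, p' n x ∈ A) : ∃ e : Module.End ℚ V,
      (∀ x, e x ∈ A) ∧ (∀ x ∈ A, e x = x) ∧ ∀ n, Commute e (p' n) := by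
  obtain ⟨g, hg⟩ := A.subtype.exists_leftInverse_of_injective A.ker_subtype
  have hgA : ∀ x ∈ A, (g x : V) = x := fun x hx =>
    congrArg Subtype.val (LinearMap.congr_fun hg ⟨x, hx⟩)
  refine ⟨weightComp p' S' 0 (A.subtype ∘ₗ g), fun x => ?_, fun x hx => ?_,
    isHomog_zero_iff.1 (hp'.isHomog_weightComp _ _)⟩
  · rw [weightComp_apply, LinearMap.sum_apply]
    exact Submodule.sum_mem _ fun n _ => hA _ _ (g _).2
  · rw [weightComp_apply, LinearMap.sum_apply]
    conv_rhs => rw [← hp'.sum_apply x]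
    refine Finset.sum_congr rfl fun n _ => ?_
    simp only [Module.End.mul_apply, LinearMap.comp_apply, Submodule.subtype_apply]
    rw [hgA _ (hA n x hx), add_zero, ← Module.End.mul_apply, hp'.mul_self]

theorem exists_nested_projections (hW : IsFiniteFiltration W) (hp' : IsResolution p' S')
    (hA : ∀ w n, ∀ x ∈ W w, p' n x ∈ W w) : ∃ q : ℤ → Module.End ℚ V,
      (∀ w x, q w x ∈ W w) ∧ (∀ w, ∀ x ∈ W w, q w x = x) ∧ (∀ w n, Commute (q w) (p' n)) ∧
      ∀ w v, w ≤ v → q w * q v = q w := by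
  choose e he he' hec using fun w => exists_projection_commute hp' (hA w)
  obtain ⟨b, hb⟩ := hW.2.2
  let Q : ℕ → Module.End ℚ V := fun n => Nat.rec 1 (fun n f => e (b - n - 1) * f) n
  have hQs : ∀ n : ℕ, Q (n + 1) = e (b - n - 1) * Q n := fun n => rfl
  have hQ : ∀ n : ℕ, (∀ x, Q n x ∈ W (b - n)) ∧ (∀ x ∈ W (b - n), Q n x = x) ∧
      ∀ m, Commute (Q n) (p' m) := fun n => by
    induction n with
    | zero =>
      refine ⟨fun x => ?_, fun x _ => rfl, fun m => Commute.one_left _⟩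
      rw [hb _ (by simp)]
      trivial
    | succ n ih =>
      obtain ⟨-, h2, h3⟩ := ih
      rw [hQs, show b - ((n + 1 : ℕ) : ℤ) = b - n - 1 by push_cast; ring]
      refine ⟨fun x => he _ _, fun x hx => ?_, fun m => (hec _ m).mul_left (h3 m)⟩
      rw [Module.End.mul_apply, h2 x (hW.1 (by omega) hx), he' _ x hx]
  have hle : ∀ w, W w = W (b - (b - w).toNat) := fun w => by
    rcases le_total w b with hw | hw
    · rw [Int.toNat_of_nonneg (by omega), sub_sub_cancel]
    · rw [Int.toNat_of_nonpos (by omega), hb w hw, hb _ (by simp)]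
  have hmem : ∀ w x, Q (b - w).toNat x ∈ W w := fun w x => by
    rw [hle]
    exact (hQ _).1 x
  have hid : ∀ w, ∀ x ∈ W w, Q (b - w).toNat x = x := fun w x hx => by
    rw [hle] at hx
    exact (hQ _).2.1 x hx
  refine ⟨fun w => Q (b - w).toNat, hmem, hid, fun w n => (hQ _).2.2 n, fun w v hwv => ?_⟩
  induction v, hwv using Int.leInduction with
  | base =>
    ext x
    exact hid w _ (hmem w x)
  | succ v _ ih =>
    have hstep : Q (b - v).toNat * Q (b - (v + 1)).toNat = Q (b - v).toNat := by
      rcases lt_or_ge v b with hv | hv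
      · rw [show (b - v).toNat = (b - (v + 1)).toNat + 1 by omega, hQs, mul_assoc]
        congr 1
        ext x
        exact hid (v + 1) _ (hmem (v + 1) x)
      · rw [Int.toNat_of_nonpos (by omega), Int.toNat_of_nonpos (by omega)]
        exact one_mul _
    dsimp only at ih ⊢
    rw [← ih, mul_assoc, hstep]

theorem exists_isFiltSplitting_commute (hW : IsFiniteFiltration W) (hp' : IsResolution p' S')
    (hA : ∀ w n, ∀ x ∈ W w, p' n x ∈ W w) : ∃ (p : ℤ → Module.End ℚ V) (S : Finset ℤ),
      IsResolution p S ∧ IsFiltSplitting p W ∧ ∀ m n, Commute (p m) (p' n) := by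
  obtain ⟨q, hmem, hid, hqc, hq⟩ := exists_nested_projections hW hp' hA
  have hq' : ∀ w v, w ≤ v → q v * q w = q w := fun w v hwv => by
    ext x
    exact hid v _ (hW.1 hwv (hmem w x))
  obtain ⟨a, ha⟩ := hW.2.1
  obtain ⟨b, hb⟩ := hW.2.2
  have hzero : ∀ w ≤ a, q w = 0 := fun w hw => by
    ext x
    have := hmem w x
    rwa [ha w hw, Submodule.mem_bot] at this
  have hone : ∀ w, b ≤ w → q w = 1 := fun w hw => by
    ext x
    exact hid w x (by rw [hb w hw]; trivial)
  refine ⟨fun w => q w - q (w - 1),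
    (Finset.range (b - a).toNat).image fun i : ℕ => a + (i + 1),
    ⟨fun i => ?_, fun i j hij => ?_, fun i hi => ?_, ?_⟩, ⟨fun m v => ?_, fun w m hm v hv => ?_⟩,
    fun m n => (hqc m n).sub_left (hqc (m - 1) n)⟩
  · rw [sub_mul, mul_sub, mul_sub, hq i i le_rfl, hq' (i - 1) i (by omega),
      hq (i - 1) i (by omega), hq (i - 1) (i - 1) le_rfl, sub_self, sub_zero]
  · rw [sub_mul, mul_sub, mul_sub]
    rcases lt_or_gt_of_ne hij with h | h
    · rw [hq i j h.le, hq i (j - 1) (by omega), hq (i - 1) j (by omega),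
        hq (i - 1) (j - 1) (by omega), sub_self, sub_self, sub_self]
    · rw [hq' j i h.le, hq' (j - 1) i (by omega), hq' j (i - 1) (by omega),
        hq' (j - 1) (i - 1) (by omega), sub_self]
  · rcases le_or_gt i a with h | h
    · rw [hzero i h, hzero (i - 1) (by omega), sub_self]
    · have hbi : b < i := by
        by_contra hbi
        refine hi (Finset.mem_image.2 ⟨(i - a - 1).toNat, Finset.mem_range.2 ?_, ?_⟩) <;> omega
      rw [hone i hbi.le, hone (i - 1) (by omega), sub_self]
  · rw [Finset.sum_image fun i _ j _ hij => by simpa using hij]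
    have := Finset.sum_range_sub (fun i : ℕ => q (a + i)) (b - a).toNat
    rw [hone _ (by omega), hzero (a + (0 : ℕ)) (by simp), sub_zero] at this
    rw [← this]
    refine Finset.sum_congr rfl fun i _ => ?_
    push_cast
    congr 2
    ring
  · exact Submodule.sub_mem _ (hmem m v) (hW.1 (by omega) (hmem (m - 1) v))
  · rw [LinearMap.sub_apply, hid m v (hW.1 hm.le hv), hid (m - 1) v (hW.1 (by omega) hv), sub_self]

theorem IsResolution.apply_mem_of_eq_iSup_inf (hp' : IsResolution p' S') {A : Submodule ℚ V}
    (hA : A = ⨆ n, A ⊓ LinearMap.range (p' n)) (n : ℤ) {x : V} (hx : x ∈ A) : p' n x ∈ A := by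
  have hle : ⨆ n, A ⊓ LinearMap.range (p' n) ≤ A.comap (p' n) := by
    refine iSup_le fun m y hy => ?_
    rw [Submodule.mem_comap]
    rcases eq_or_ne n m with rfl | hnm
    · rw [hp'.mem_range_iff.1 hy.2]
      exact hy.1
    · rw [← hp'.mem_range_iff.1 hy.2, ← Module.End.mul_apply, hp'.mul_ne n m hnm]
      exact Submodule.zero_mem _
  exact hle (hA ▸ hx)

end ExistsSplitting

/-- Deligne: given a splitting `U'` of the relative monodromy filtration `W'`
with `N(U'_w) ⊆ U'_{w-2}` and compatible with `W`, there is a unique splitting `U` of `W`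
such that `V = ⊕_{m,n} (U_m ∩ U'_n)` and, for the weight components `N_w` of `N` with
respect to `U`, the class `N̄_{-1}` in `gr^{W'}_{-2} gr^W_{-1} End(V)` is zero and for every
`w ≤ -2` the class `N̄_w` lies in the primitive component of `gr^{W'}_{-2} gr^W_w End(V)`. -/
theorem deligne_splitting_exists_unique
    {V : Type*} [AddCommGroup V] [Module ℚ V] [FiniteDimensional ℚ V]
    (W W' : ℤ → Submodule ℚ V) (hW : IsFiniteFiltration W)
    (N : Module.End ℚ V) (hNnil : IsNilpotent N)
    (hNW : ∀ w : ℤ, ∀ x ∈ W w, N x ∈ W w)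
    (h : IsRelMonFil N W W')
    (U' : ℤ → Submodule ℚ V) (hU' : IsSplitting W' U')
    (hNU' : ∀ w : ℤ, ∀ x ∈ U' w, N x ∈ U' (w - 2))
    (hcompat : ∀ w : ℤ, W w = ⨆ n : ℤ, W w ⊓ U' n) :
    ∃! U : ℤ → Submodule ℚ V, IsDeligneSplitting N W W' U' U := by
  obtain ⟨p', S', hp', hpU'⟩ := exists_isResolution_of_isInternal hU'.1
  obtain rfl : (fun n => LinearMap.range (p' n)) = U' := funext hpU'
  have hs' := (hp'.isSplitting_range_iff h.1.1).1 hU'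
  have hN' : IsHomog p' (-2) N := hp'.isHomog_of_mapsTo hNU'
  have hN : N ∈ endFilt W 0 := fun w x hx => by simpa using hNW w x hx
  have hbi : ∀ {p S}, IsResolution p S → IsFiltSplitting p W → (∀ m n, Commute (p m) (p' n)) →
      IsBisplitting N W W' p p' S S' := fun hp hs hc =>
    ⟨hW.1, h, hN, hp, hs, hp', hs', hN', hc⟩
  have hiff : ∀ {p S}, IsBisplitting N W W' p p' S S' →
      (IsDeligneSplitting N W W' (fun n => LinearMap.range (p' n))
        (fun m => LinearMap.range (p m)) ↔ HasPrimitiveComps p S N) := fun hp =>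
    isDeligneSplitting_range_iff hp.isResolution hp.isFiltSplitting hW.1 hp' hs' h.1.1 hp.commute
      hN hN'
  obtain ⟨p, S, hp, hs, hc⟩ := exists_isFiltSplitting_commute hW hp' fun w n _ hx =>
    hp'.apply_mem_of_eq_iSup_inf (hcompat w) n hx
  obtain ⟨u, hu, hprim⟩ := (hbi hp hs hc).exists_isGauge_hasPrimitiveComps hW
  have hconj := (hbi hp hs hc).conj hu
  refine ⟨_, (hiff hconj).2 hprim, fun U hU => ?_⟩
  obtain ⟨q, T, hq, hqU⟩ := exists_isResolution_of_isInternal hU.1.1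
  obtain rfl : (fun n => LinearMap.range (q n)) = U := funext hqU
  have hqs := (hq.isSplitting_range_iff hW.1).1 hU.1
  have hqc := hq.commute_of_isInternal_inf hp' hU.2.1
  have hbi₁ := hbi (hconj.isResolution.mono (Finset.subset_union_left (s₂ := T)))
    hconj.isFiltSplitting hconj.commute
  have hbi₂ := hbi (hq.mono (Finset.subset_union_right (s₁ := S))) hqs hqc
  rw [hbi₁.eq_of_hasPrimitiveComps hW hbi₂ ((hiff hbi₁).1 ((hiff hconj).2 hprim))
    ((hiff hbi₂).1 hU)]
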